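/- For every integer n ≥ 5, every subgroup H of the generalised Higman group H_n which is not cyclic either admits an injective group homomorphism into the Baumslag–Solitar group BS(1,2), or is acylindrically hyperbolic. -/

import Mathlib

def higmanRels (n : ℕ) : Set (FreeGroup (ZMod n)) :=
  {r | ∃ i : ZMod n,
    r = FreeGroup.of i * FreeGroup.of (i + 1) * (FreeGroup.of i)⁻¹ * ((FreeGroup.of (i + 1))⁻¹) ^ 2}

abbrev HigmanGroup (n : ℕ) : Type := PresentedGroup (higmanRels n)

def bsRels : Set (FreeGroup (Fin 2)) :=
  {FreeGroup.of 0 * FreeGroup.of 1 * (FreeGroup.of 0)⁻¹ * ((FreeGroup.of 1)⁻¹) ^ 2}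

abbrev BS12 : Type := PresentedGroup bsRels

def IsGeodesicSpace (X : Type*) [MetricSpace X] : Prop :=
  ∀ x y : X, ∃ γ : ℝ → X, γ 0 = x ∧ γ (dist x y) = y ∧
    ∀ s ∈ Set.Icc (0 : ℝ) (dist x y), ∀ t ∈ Set.Icc (0 : ℝ) (dist x y),
      dist (γ s) (γ t) = |s - t|

def IsGromovHyperbolic (X : Type*) [MetricSpace X] : Prop :=
  ∃ δ : ℝ, 0 ≤ δ ∧ ∀ x y z w : X,
    (dist x w + dist z w - dist x z) / 2 ≥
      min ((dist x w + dist y w - dist x y) / 2) ((dist y w + dist z w - dist y z) / 2) - δ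

def IsAcylindricalAction {G X : Type*} [Group G] [MetricSpace X] (act : G → X → X) : Prop :=
  ∀ r : ℝ, 0 ≤ r → ∃ (L : ℝ) (N : ℕ), 0 ≤ L ∧ ∀ x y : X, L ≤ dist x y →
    {g : G | dist x (act g x) ≤ r ∧ dist y (act g y) ≤ r}.Finite ∧
    {g : G | dist x (act g x) ≤ r ∧ dist y (act g y) ≤ r}.ncard ≤ N

def IsVirtuallyCyclic (G : Type*) [Group G] : Prop :=
  ∃ H : Subgroup G, IsCyclic H ∧ H.FiniteIndex

def GoodAcylAction (G : Type*) [Group G] (X : Type*) [MetricSpace X] (act : G → X → X) : Prop :=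
  (∀ g : G, Isometry (act g)) ∧
  (∀ x : X, act 1 x = x) ∧
  (∀ (g h : G) (x : X), act (g * h) x = act g (act h x)) ∧
  IsGeodesicSpace X ∧ IsGromovHyperbolic X ∧ IsAcylindricalAction act ∧
  ∃ x : X, ¬ Bornology.IsBounded (Set.range fun g : G => act g x)

def IsAcylindricallyHyperbolic (G : Type*) [Group G] : Prop :=
  ¬ IsVirtuallyCyclic G ∧
  ∃ (X : Type) (m : MetricSpace X) (act : G → X → X), @GoodAcylAction G _ X m act

/-- An integer-valued metric which is the vertex metric of a simplicial tree. -/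
structure IsTreeMetric {V : Type*} (d : V → V → ℕ) : Prop where
  self : ∀ x, d x x = 0
  symm : ∀ x y, d x y = d y x
  eq_of_zero : ∀ x y, d x y = 0 → x = y
  four_point : ∀ x y z w, d x y + d z w ≤ max (d x z + d y w) (d x w + d y z)
  between : ∀ x y i, i ≤ d x y → ∃ z, d x z = i ∧ i + d z y = d x y

namespace IsTreeMetric

variable {V : Type*} {d : V → V → ℕ}

theorem triangle (hd : IsTreeMetric d) (x y z : V) : d x z ≤ d x y + d y z := by
  have h1 := hd.four_point x z y y
  have h2 := hd.self y
  have h3 := hd.symm z y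
  omega

theorem eq_of_between (hd : IsTreeMetric d) {x y z z' : V} (hz : d x z + d z y = d x y)
    (hz' : d x z' + d z' y = d x y) (h : d x z = d x z') : z = z' := by
  apply hd.eq_of_zero
  have h1 := hd.four_point z z' x y
  have := hd.symm x z
  have := hd.symm x z'
  omega

theorem between_of_near (hd : IsTreeMetric d) {x y z p : V} (hz : d x z + d z y = d x y)
    (hp : d p x ≤ d x z) : d p z + d z y = d p y := by
  have h1 := hd.four_point p z x y
  have h2 := hd.triangle p z y
  have h3 := hd.symm z x
  have h4 : d p z = 0 → d z y = d p y := fun h => by rw [hd.eq_of_zero _ _ h]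
  omega

theorem mem_of_chain (hd : IsTreeMetric d) {r : V → V → Prop} (hr : ∀ x y, r x y → d x y = 1)
    {x y p : V} (hxy : Relation.ReflTransGen r x y) (hp : d x p + d p y = d x y) :
    Relation.ReflTransGen r x p := by
  by_contra hcon
  have key : ∀ z, Relation.ReflTransGen r x z → d x z < d x p + d p z := by
    intro z hz
    induction hz with
    | refl =>
      rw [hd.self]
      rcases Nat.eq_zero_or_pos (d x p) with h | h
      · rw [hd.eq_of_zero _ _ h] at hcon
        exact absurd .refl hcon
      · omega
    | @tail b c hb hbc ih =>
      have h0 : d p c ≠ 0 := fun h => hcon (by rw [hd.eq_of_zero _ _ h]; exact hb.tail hbc)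
      have h0' : d p b ≠ 0 := fun h => hcon (by rw [hd.eq_of_zero _ _ h]; exact hb)
      have h1 := hr _ _ hbc
      have h2 := hd.four_point x c b p
      have h3 := hd.symm b p
      have h4 := hd.symm c p
      have h5 := hd.symm c b
      omega
  have := key y hxy
  omega

section Action

variable {G : Type*} [Group G] [MulAction G V]

theorem smul_eq_of_between (hd : IsTreeMetric d) (hG : ∀ (g : G) x y, d (g • x) (g • y) = d x y)
    {g : G} {x y z : V} (hx : g • x = x) (hy : g • y = y) (hz : d x z + d z y = d x y) :
    g • z = z := by
  have h1 := hG g x z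
  have h2 := hG g z y
  rw [hx] at h1
  rw [hy] at h2
  exact hd.eq_of_between (by omega) hz h1

/-- A group acting on a tree with a bounded orbit all of whose mutual distances are even fixes the
midpoint of two points of the orbit. -/
theorem exists_fixed (hd : IsTreeMetric d) (hG : ∀ (g : G) x y, d (g • x) (g • y) = d x y) (o : V)
    (heven : ∀ g : G, Even (d o (g • o))) (N : ℕ) (hN : ∀ g : G, d o (g • o) ≤ N) :
    ∃ c, (∀ g : G, g • c = c) ∧ ∃ g : G, d o c + d c (g • o) = d o (g • o) := by
  obtain ⟨g, hg⟩ : ∃ g : G, ∀ h : G, d o (h • o) ≤ d o (g • o) := by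
    have hfin : (Set.range fun g : G => d o (g • o)).Finite :=
      (Set.finite_Iic N).subset (by rintro _ ⟨g, rfl⟩; exact hN g)
    obtain ⟨m, ⟨g, rfl⟩, hm⟩ := hfin.exists_maximal (Set.range_nonempty _)
    exact ⟨g, fun h => by
      by_contra hlt
      exact hlt (hm ⟨h, rfl⟩ (by simp only; omega))⟩
  have hmax : ∀ h k : G, d (h • o) (k • o) ≤ d o (g • o) := by
    intro h k
    have := hG h o ((h⁻¹ * k) • o)
    rw [smul_smul, mul_inv_cancel_left] at this
    rw [this]
    exact hg _
  obtain ⟨m, hm⟩ := heven g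
  obtain ⟨c, hc1, hc2⟩ := hd.between o (g • o) m (by omega)
  refine ⟨c, fun h => ?_, g, by omega⟩
  have hcen : ∀ k : G, d c (k • o) ≤ m := by
    intro k
    have h1 := hd.four_point c (k • o) o (g • o)
    have h2 := hmax k 1
    have h3 := hmax k g
    rw [one_smul] at h2
    have h4 := hd.symm c o
    omega
  have e1 := hcen h⁻¹
  have e2 := hcen (h⁻¹ * g)
  have e3 := hG h c (h⁻¹ • o)
  have e4 := hG h c ((h⁻¹ * g) • o)
  rw [smul_smul, mul_inv_cancel, one_smul] at e3
  rw [smul_smul, mul_inv_cancel_left] at e4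
  have e5 := hd.triangle o (h • c) (g • o)
  have e6 := hd.symm o (h • c)
  exact hd.eq_of_between (x := o) (y := g • o) (by omega) (by omega) (by omega)

/-- Sela acylindricity implies Bowditch acylindricity for trees. -/
theorem finite_of_far (hd : IsTreeMetric d) (hG : ∀ (g : G) x y, d (g • x) (g • y) = d x y) (k : ℕ)
    (hk : ∀ (g : G) x y, d x y = k → g • x = x → g • y = y → g = 1) (R : ℕ) {p q : V}
    (hpq : 2 * R + k ≤ d p q) :
    {g : G | d p (g • p) ≤ R ∧ d q (g • q) ≤ R}.Finite ∧
    {g : G | d p (g • p) ≤ R ∧ d q (g • q) ≤ R}.ncard ≤ 2 * R + 1 := by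
  obtain ⟨m, hm1, hm2⟩ := hd.between p q R (by omega)
  obtain ⟨m', hm1', hm2'⟩ := hd.between m q k (by omega)
  have hpm' : d p m' = R + k := by
    have := hd.triangle p m m'
    have := hd.triangle p m' q
    omega
  have step : ∀ g : G, d p (g • p) ≤ R → d q (g • q) ≤ R →
      d p (g • m) + d (g • m) q = d p q ∧ d p (g • m') + d (g • m') q = d p q ∧
      d p (g • m') = d p (g • m) + k ∧ d p (g • m) ≤ 2 * R := by
    intro g h1 h2
    have a1 := hG g p m
    have a2 := hG g m q
    have a3 := hG g p q
    have a4 := hG g p m'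
    have a5 := hG g m' q
    have a6 := hG g m m'
    have b1 := hd.between_of_near (x := g • p) (y := g • q) (z := g • m) (p := p)
      (by omega) (by omega)
    have b2 := hd.between_of_near (x := g • p) (y := g • q) (z := g • m') (p := p)
      (by omega) (by omega)
    have b3 := hd.between_of_near (x := g • p) (y := g • m') (z := g • m) (p := p)
      (by omega) (by omega)
    have s1 := hd.symm p (g • q)
    have s2 := hd.symm q (g • q)
    have s3 := hd.symm (g • m) (g • q)
    have s4 := hd.symm p (g • m)
    have s5 := hd.symm (g • m') (g • q)
    have s6 := hd.symm p (g • m')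
    have c1 := hd.between_of_near (x := g • q) (y := p) (z := g • m) (p := q)
      (by omega) (by omega)
    have c2 := hd.between_of_near (x := g • q) (y := p) (z := g • m') (p := q)
      (by omega) (by omega)
    have s7 := hd.symm q (g • m)
    have s8 := hd.symm q (g • m')
    have s9 := hd.symm q p
    have t := hd.triangle p (g • p) (g • m)
    refine ⟨by omega, by omega, by omega, by omega⟩
  have hinj : Set.InjOn (fun g : G => d p (g • m)) {g : G | d p (g • p) ≤ R ∧ d q (g • q) ≤ R} := by
    rintro g ⟨h1, h2⟩ h ⟨h3, h4⟩ hgh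
    simp only at hgh
    obtain ⟨u1, u2, u3, -⟩ := step g h1 h2
    obtain ⟨v1, v2, v3, -⟩ := step h h3 h4
    have w1 := hd.eq_of_between u1 v1 hgh
    have w2 := hd.eq_of_between u2 v2 (by omega)
    have := hk (g⁻¹ * h) m m' hm1' (by rw [mul_smul, ← w1, inv_smul_smul])
      (by rw [mul_smul, ← w2, inv_smul_smul])
    exact (inv_mul_eq_one.mp this)
  have hmaps : Set.MapsTo (fun g : G => d p (g • m)) {g : G | d p (g • p) ≤ R ∧ d q (g • q) ≤ R}
      (Finset.range (2 * R + 1) : Finset ℕ) := by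
    rintro g ⟨h1, h2⟩
    have := (step g h1 h2).2.2.2
    simp only [Finset.coe_range, Set.mem_Iio]
    omega
  refine ⟨Set.Finite.of_injOn hmaps hinj (Finset.finite_toSet _), ?_⟩
  have := Set.ncard_le_ncard_of_injOn _ hmaps hinj (Finset.finite_toSet _)
  simpa using this

end Action

end IsTreeMetric

namespace SimpleGraph

variable {V : Type*} {Γ : SimpleGraph V}

theorem IsTree.dist_eq_add_one (hΓ : Γ.IsTree) {w x a b : V} (ha : Γ.Adj a x) (hb : Γ.Adj b x)
    (hab : a ≠ b) (h : Γ.dist w x = Γ.dist w a + 1) : Γ.dist w b = Γ.dist w x + 1 := by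
  have hconn := hΓ.connected
  by_contra hne
  have hlt : Γ.dist w x = Γ.dist w b + 1 := by
    have h1 := hb.diff_dist_adj (u := w)
    have h2 : Γ.dist w b ≠ Γ.dist w x := hΓ.dist_ne_of_adj w hb
    omega
  obtain ⟨p, hp⟩ := hconn.exists_walk_length_eq_dist w a
  obtain ⟨q, hq⟩ := hconn.exists_walk_length_eq_dist w b
  have hp' : (p.concat ha).IsPath := Walk.isPath_of_length_eq_dist _ (by simp [hp, h])
  have hq' : (q.concat hb).IsPath := Walk.isPath_of_length_eq_dist _ (by simp [hq, hlt])
  have := congrArg Walk.penultimate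
    (congrArg Subtype.val ((hΓ.isAcyclic.subsingleton_path _ _).elim ⟨_, hp'⟩ ⟨_, hq'⟩))
  simp only [Walk.penultimate_concat] at this
  exact hab this

theorem Connected.exists_adj_dist (hΓ : Γ.Connected) {x y : V} (hxy : x ≠ y) :
    ∃ z, Γ.Adj x z ∧ Γ.dist x y = Γ.dist z y + 1 := by
  obtain ⟨p, hp⟩ := hΓ.exists_walk_length_eq_dist x y
  cases p with
  | nil => exact absurd rfl hxy
  | @cons _ z _ h q =>
    refine ⟨z, h, ?_⟩
    have h1 := dist_le q
    have h2 := hΓ.dist_triangle (u := x) (v := z) (w := y)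
    rw [dist_eq_one_iff_adj.mpr h] at h2
    simp only [Walk.length_cons] at hp
    omega

theorem IsTree.dist_eq_of_step (hΓ : Γ.IsTree) {y : V} (n : ℕ) : ∀ {x x' z : V}, Γ.Adj x x' →
    Γ.dist x z = n + 1 → Γ.dist x' z = n → Γ.dist y x' = Γ.dist y x + 1 →
    Γ.dist y z = Γ.dist y x + Γ.dist x z := by
  induction n with
  | zero =>
    intro x x' z _ h1 h2 h3
    rw [hΓ.connected.dist_eq_zero_iff] at h2
    subst h2
    omega
  | succ n ih =>
    intro x x' z hadj h1 h2 h3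
    obtain ⟨x'', hadj', h4⟩ := hΓ.connected.exists_adj_dist (x := x') (y := z) (by
      rintro rfl
      simp at h2)
    have hne : x ≠ x'' := by
      rintro rfl
      omega
    have h5 := hΓ.dist_eq_add_one hadj hadj'.symm hne h3
    have := ih hadj' h2 (by omega) h5
    omega

theorem IsTree.dist_add_dist (hΓ : Γ.IsTree) {x y z y' z' : V} (hy : Γ.Adj x y')
    (hz : Γ.Adj x z') (hy' : Γ.dist x y = Γ.dist y' y + 1) (hz' : Γ.dist x z = Γ.dist z' z + 1)
    (hne : y' ≠ z') : Γ.dist y z = Γ.dist y x + Γ.dist x z := by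
  refine hΓ.dist_eq_of_step _ hz hz' rfl ?_
  refine hΓ.dist_eq_add_one hy.symm hz.symm hne ?_
  rw [dist_comm, hy', dist_comm]

theorem IsTree.four_point (hΓ : Γ.IsTree) (N : ℕ) : ∀ x y z w : V,
    Γ.dist x y + Γ.dist x z + Γ.dist x w ≤ N →
    Γ.dist x y + Γ.dist z w ≤ max (Γ.dist x z + Γ.dist y w) (Γ.dist x w + Γ.dist y z) := by
  induction N using Nat.strong_induction_on with
  | _ N ih =>
  intro x y z w hN
  have hconn := hΓ.connected
  rcases eq_or_ne x y with rfl | hxy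
  · have := hconn.dist_triangle (u := z) (v := x) (w := w)
    simp only [dist_self]
    rw [dist_comm (u := z) (v := x)] at this
    omega
  rcases eq_or_ne x z with rfl | hxz
  · simp only [dist_self, dist_comm (u := y) (v := x)]
    omega
  rcases eq_or_ne x w with rfl | hxw
  · simp only [dist_self, dist_comm (u := y) (v := x), dist_comm (u := z) (v := x)]
    omega
  obtain ⟨a, ha, ha'⟩ := hconn.exists_adj_dist hxy
  obtain ⟨b, hb, hb'⟩ := hconn.exists_adj_dist hxz
  obtain ⟨c, hc, hc'⟩ := hconn.exists_adj_dist hxw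
  have s1 := Γ.dist_comm (u := y) (v := x)
  have s2 := Γ.dist_comm (u := z) (v := x)
  have t1 := hconn.dist_triangle (u := z) (v := x) (w := w)
  have t2 := hconn.dist_triangle (u := y) (v := x) (w := w)
  by_cases hab : a = b
  · by_cases hac : a = c
    · subst hab hac
      have := ih (Γ.dist a y + Γ.dist a z + Γ.dist a w) (by omega) a y z w le_rfl
      omega
    · have := hΓ.dist_add_dist ha hc ha' hc' hac
      omega
  · have h1 := hΓ.dist_add_dist ha hb ha' hb' hab
    omega

theorem IsTree.isTreeMetric (hΓ : Γ.IsTree) : IsTreeMetric Γ.dist where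
  self _ := dist_self
  symm _ _ := dist_comm
  eq_of_zero _ _ h := hΓ.connected.dist_eq_zero_iff.mp h
  four_point x y z w := hΓ.four_point _ x y z w le_rfl
  between x y i hi := by
    obtain ⟨p, hp⟩ := hΓ.connected.exists_walk_length_eq_dist x y
    refine ⟨p.getVert i, ?_⟩
    have h1 := dist_le (p.take i)
    have h2 := dist_le (p.drop i)
    have h3 := hΓ.connected.dist_triangle (u := x) (v := p.getVert i) (w := y)
    rw [Walk.take_length] at h1
    rw [Walk.drop_length] at h2
    omega

end SimpleGraph

/-- The tight span of an integer-valued metric. -/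
structure TightSpan {V : Type} (d : V → V → ℕ) where
  toFun : V → ℝ
  le_add : ∀ x y, (d x y : ℝ) ≤ toFun x + toFun y
  extremal : ∀ x, ∀ ε > 0, ∃ y, toFun x + toFun y ≤ d x y + ε

namespace TightSpan

variable {V : Type} {d : V → V → ℕ}

instance : CoeFun (TightSpan d) fun _ => V → ℝ := ⟨toFun⟩

theorem coe_injective {f g : TightSpan d} (h : ∀ x, f x = g x) : f = g := by
  obtain ⟨f, _, _⟩ := f
  obtain ⟨g, _, _⟩ := g
  obtain rfl : f = g := funext h
  rfl

theorem lipschitz (hd : IsTreeMetric d) (f : TightSpan d) (x y : V) : f x ≤ f y + d x y := by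
  refine le_of_forall_pos_le_add fun ε hε => ?_
  obtain ⟨z, hz⟩ := f.extremal x ε hε
  have h1 := f.le_add y z
  have h2 : (d x z : ℝ) ≤ d x y + d y z := mod_cast hd.triangle x y z
  linarith

/-- The supremum distance. -/
noncomputable def sdist (f g : TightSpan d) : ℝ := ⨆ x, |f x - g x|

theorem bddAbove (hd : IsTreeMetric d) (f g : TightSpan d) :
    BddAbove (Set.range fun x => |f x - g x|) := by
  by_cases hV : Nonempty V
  · obtain ⟨o⟩ := hV
    refine ⟨f o + g o, ?_⟩
    rintro _ ⟨x, rfl⟩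
    have h1 := f.lipschitz hd x o
    have h2 := g.lipschitz hd x o
    have h3 := f.le_add x o
    have h4 := g.le_add x o
    simp only
    rw [abs_le]
    constructor <;> linarith
  · exact ⟨0, by rintro _ ⟨x, rfl⟩; exact absurd ⟨x⟩ hV⟩

theorem abs_sub_le (hd : IsTreeMetric d) (f g : TightSpan d) (x : V) : |f x - g x| ≤ sdist f g :=
  le_ciSup (f.bddAbove hd g) x

theorem le_add_sdist (hd : IsTreeMetric d) (f g : TightSpan d) (x : V) : f x ≤ g x + sdist f g := by
  have := (le_abs_self _).trans (f.abs_sub_le hd g x)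
  linarith

theorem sdist_comm (f g : TightSpan d) : sdist f g = sdist g f := by
  simp only [sdist, abs_sub_comm]

theorem sub_le_sdist (hd : IsTreeMetric d) (f g : TightSpan d) (a b : V) :
    d a b - f a - g b ≤ sdist f g := by
  have h1 := g.le_add a b
  have h2 := g.le_add_sdist hd f a
  rw [sdist_comm] at h2
  linarith

/-- The point of the tight span represented by a vertex. -/
def vertex (hd : IsTreeMetric d) (v : V) : TightSpan d where
  toFun x := d x v
  le_add x y := by
    have := hd.triangle x v y
    rw [hd.symm v y] at this
    exact mod_cast this
  extremal x ε hε := ⟨v, by simp [hd.self]; linarith⟩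

theorem vertex_apply (hd : IsTreeMetric d) (v x : V) : vertex hd v x = d x v := rfl

section Action

variable {G : Type} [Group G] [MulAction G V]

/-- The action on the tight span induced by an isometric action. -/
def act (hG : ∀ (g : G) x y, d (g • x) (g • y) = d x y) (g : G) (f : TightSpan d) :
    TightSpan d where
  toFun x := f (g⁻¹ • x)
  le_add x y := by
    rw [← hG g⁻¹ x y]
    exact f.le_add _ _
  extremal x ε hε := by
    obtain ⟨y, hy⟩ := f.extremal (g⁻¹ • x) ε hε
    refine ⟨g • y, ?_⟩
    rw [inv_smul_smul, ← hG g⁻¹ x, inv_smul_smul]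
    exact hy

theorem act_apply (hG : ∀ (g : G) x y, d (g • x) (g • y) = d x y) (g : G) (f : TightSpan d)
    (x : V) : act hG g f x = f (g⁻¹ • x) := rfl

theorem sdist_act (hG : ∀ (g : G) x y, d (g • x) (g • y) = d x y) (g : G) (f f' : TightSpan d) :
    sdist (act hG g f) (act hG g f') = sdist f f' :=
  (MulAction.toPerm g⁻¹ : Equiv.Perm V).iSup_comp (g := fun x => |f x - f' x|)

end Action

variable [Nonempty V]

theorem sdist_le {f g : TightSpan d} {c : ℝ} (h : ∀ x, |f x - g x| ≤ c) : sdist f g ≤ c :=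
  ciSup_le h

variable (d) in
/-- The supremum metric on the tight span. -/
@[reducible] noncomputable def metricSpace (hd : IsTreeMetric d) : MetricSpace (TightSpan d) where
  dist := sdist
  dist_self f := by simp [sdist]
  dist_comm := sdist_comm
  dist_triangle f g h := sdist_le fun x => by
    have h1 := f.abs_sub_le hd g x
    have h2 := g.abs_sub_le hd h x
    have h3 := _root_.abs_sub_le (f x) (g x) (h x)
    linarith
  eq_of_dist_eq_zero {f g} h := coe_injective fun x => by
    have h1 : |f x - g x| ≤ sdist f g := f.abs_sub_le hd g x
    have h2 : sdist f g = 0 := h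
    rw [h2] at h1
    exact sub_eq_zero.mp (abs_eq_zero.mp (le_antisymm h1 (abs_nonneg _)))

theorem exists_far (hd : IsTreeMetric d) (f g : TightSpan d) {ε : ℝ} (hε : 0 < ε) :
    ∃ a b, sdist f g ≤ d a b - f a - g b + ε := by
  obtain ⟨x, hx⟩ := exists_lt_of_lt_ciSup (show sdist f g - ε / 2 < ⨆ x, |f x - g x| by
    simp only [sdist]; linarith)
  obtain ⟨y, hy⟩ := f.extremal x (ε / 2) (by linarith)
  obtain ⟨z, hz⟩ := g.extremal x (ε / 2) (by linarith)
  rcases abs_cases (f x - g x) with ⟨h, -⟩ | ⟨h, -⟩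
  · refine ⟨y, x, ?_⟩
    rw [hd.symm y x]
    linarith
  · exact ⟨x, z, by linarith⟩

theorem four_point (hd : IsTreeMetric d) (f g h k : TightSpan d) :
    sdist f g + sdist h k ≤ max (sdist f h + sdist g k) (sdist f k + sdist g h) := by
  refine le_of_forall_pos_le_add fun ε hε => ?_
  obtain ⟨x, y, hxy⟩ := f.exists_far hd g (half_pos hε)
  obtain ⟨z, w, hzw⟩ := h.exists_far hd k (half_pos hε)
  have h1 := f.sub_le_sdist hd h x z
  have h2 := g.sub_le_sdist hd k y w
  have h3 := f.sub_le_sdist hd k x w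
  have h4 := g.sub_le_sdist hd h y z
  have h5 : (d x y : ℝ) + d z w ≤ max (d x z + d y w : ℝ) (d x w + d y z) :=
    mod_cast hd.four_point x y z w
  rcases le_max_iff.mp h5 with h6 | h6
  · refine le_trans ?_ (add_le_add_left (le_max_left _ _) _)
    linarith
  · refine le_trans ?_ (add_le_add_left (le_max_right _ _) _)
    linarith

theorem sdist_vertex (hd : IsTreeMetric d) (f : TightSpan d) (v : V) :
    sdist f (vertex hd v) = f v := by
  apply le_antisymm
  · refine sdist_le fun x => ?_
    have h1 := f.lipschitz hd x v
    have h2 := f.le_add x v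
    rw [abs_le]
    constructor <;> simp only [vertex_apply] <;> linarith
  · have := f.le_add_sdist hd (vertex hd v) v
    simpa [vertex_apply, hd.self] using this

theorem vertex_sdist (hd : IsTreeMetric d) (f : TightSpan d) (v : V) :
    sdist (vertex hd v) f = f v := by
  rw [sdist_comm, sdist_vertex]

theorem vertex_four_point (hd : IsTreeMetric d) (f g : TightSpan d) (x y : V) :
    d x y + sdist f g ≤ max (f x + g y) (f y + g x) := by
  have := four_point hd f g (vertex hd x) (vertex hd y)
  rw [sdist_vertex, sdist_vertex, sdist_vertex, sdist_vertex, sdist_vertex] at this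
  rw [vertex_apply, hd.symm y x] at this
  linarith

theorem extremal_of_le (hd : IsTreeMetric d) (f g : TightSpan d) {t : ℝ} (ht : 0 ≤ t)
    (x : V) (hx : g x - (sdist f g - t) ≤ f x - t) {ε : ℝ} (hε : 0 < ε) :
    ∃ y, f x - t + max (f y - t) (g y - (sdist f g - t)) ≤ d x y + ε := by
  rcases ht.eq_or_lt with rfl | ht
  · obtain ⟨y, hy⟩ := f.extremal x ε hε
    refine ⟨y, ?_⟩
    have := g.le_add_sdist hd f y
    rw [sdist_comm] at this
    rw [max_eq_left (by linarith)]
    linarith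
  · obtain ⟨a, b, hab⟩ := f.exists_far hd g (lt_min hε ht)
    have e1 := min_le_left ε t
    have e2 := min_le_right ε t
    refine ⟨a, ?_⟩
    have h1 : max (f a - t) (g a - (sdist f g - t)) ≤ f a + t := by
      have := g.le_add_sdist hd f a
      rw [sdist_comm] at this
      exact max_le (by linarith) (by linarith)
    have h2 := four_point hd f (vertex hd x) g (vertex hd a)
    rw [sdist_vertex, sdist_vertex, sdist_vertex, sdist_vertex, vertex_sdist, vertex_apply, hd.symm a x] at h2
    have h3 := g.le_add a b
    rcases le_max_iff.mp h2 with h4 | h4 <;> linarith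

/-- The geodesic between two points of the tight span of a tree. -/
noncomputable def path (hd : IsTreeMetric d) (f g : TightSpan d) (t : ℝ) (h0 : 0 ≤ t)
    (h1 : t ≤ sdist f g) : TightSpan d where
  toFun x := max (f x - t) (g x - (sdist f g - t))
  le_add x y := by
    have a1 := le_max_left (f x - t) (g x - (sdist f g - t))
    have a2 := le_max_right (f x - t) (g x - (sdist f g - t))
    have a3 := le_max_left (f y - t) (g y - (sdist f g - t))
    have a4 := le_max_right (f y - t) (g y - (sdist f g - t))
    have := vertex_four_point hd f g x y
    rcases le_max_iff.mp this with h | h <;> linarith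
  extremal x ε hε := by
    rcases le_total (g x - (sdist f g - t)) (f x - t) with h | h
    · obtain ⟨y, hy⟩ := extremal_of_le hd f g h0 x h hε
      exact ⟨y, by rwa [max_eq_left h]⟩
    · obtain ⟨y, hy⟩ := extremal_of_le hd g f (t := sdist f g - t) (by linarith) x
        (by rw [sdist_comm g f]; linarith) hε
      refine ⟨y, ?_⟩
      rw [sdist_comm g f, sub_sub_cancel, max_comm] at hy
      rwa [max_eq_right h]

theorem isGeodesicSpace (hd : IsTreeMetric d) :
    @IsGeodesicSpace (TightSpan d) (metricSpace d hd) := by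
  let := metricSpace d hd
  intro f g
  change ∃ γ : ℝ → TightSpan d, γ 0 = f ∧ γ (sdist f g) = g ∧
    ∀ s ∈ Set.Icc (0 : ℝ) (sdist f g), ∀ t ∈ Set.Icc (0 : ℝ) (sdist f g),
      sdist (γ s) (γ t) = |s - t|
  have hpos : 0 ≤ sdist f g := dist_nonneg (x := f) (y := g)
  set γ : ℝ → TightSpan d := fun t => path hd f g (max 0 (min t (sdist f g))) (le_max_left _ _)
    (max_le hpos (min_le_right _ _)) with hγ
  have hval : ∀ t ∈ Set.Icc (0 : ℝ) (sdist f g), ∀ x,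
      γ t x = max (f x - t) (g x - (sdist f g - t)) := by
    intro t ht x
    simp only [hγ, path, min_eq_left ht.2, max_eq_right ht.1]
  have h0 : γ 0 = f := coe_injective fun x => by
    rw [hval 0 ⟨le_rfl, hpos⟩, max_eq_left, sub_zero]
    have := g.le_add_sdist hd f x
    rw [sdist_comm] at this
    linarith
  have h1 : γ (sdist f g) = g := coe_injective fun x => by
    rw [hval _ ⟨hpos, le_rfl⟩, max_eq_right, sub_self, sub_zero]
    have := f.le_add_sdist hd g x
    linarith
  have hle : ∀ s ∈ Set.Icc (0 : ℝ) (sdist f g), ∀ t ∈ Set.Icc (0 : ℝ) (sdist f g),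
      sdist (γ s) (γ t) ≤ |s - t| := by
    intro s hs t ht
    refine sdist_le fun x => ?_
    rw [hval s hs, hval t ht]
    refine (abs_max_sub_max_le_max _ _ _ _).trans (max_le ?_ ?_)
    · rw [abs_sub_comm s t]
      exact le_of_eq (congrArg _ (by ring))
    · exact le_of_eq (congrArg _ (by ring))
  have main : ∀ s t, 0 ≤ s → s ≤ t → t ≤ sdist f g → sdist (γ s) (γ t) = |s - t| := by
    intro s t hs hst ht
    have hs' : s ∈ Set.Icc (0 : ℝ) (sdist f g) := ⟨hs, hst.trans ht⟩
    have ht' : t ∈ Set.Icc (0 : ℝ) (sdist f g) := ⟨hs.trans hst, ht⟩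
    apply le_antisymm (hle s hs' t ht')
    have a1 := hle 0 ⟨le_rfl, hpos⟩ s hs'
    have a2 := hle t ht' _ ⟨hpos, le_rfl⟩
    rw [h0] at a1
    rw [h1] at a2
    have a3 : sdist f g ≤ sdist f (γ s) + sdist (γ s) g := dist_triangle f (γ s) g
    have a4 : sdist (γ s) g ≤ sdist (γ s) (γ t) + sdist (γ t) g := dist_triangle (γ s) (γ t) g
    rw [abs_of_nonpos (by linarith)] at a1 a2 ⊢
    linarith
  refine ⟨γ, h0, h1, fun s hs t ht => ?_⟩
  rcases le_total s t with h | h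
  · exact main s t hs.1 h ht.2
  · rw [sdist_comm, abs_sub_comm]
    exact main t s ht.1 h hs.2

theorem isGromovHyperbolic (hd : IsTreeMetric d) :
    @IsGromovHyperbolic (TightSpan d) (metricSpace d hd) := by
  let := metricSpace d hd
  refine ⟨0, le_rfl, fun x y z w => ?_⟩
  have h : dist x z + dist y w ≤ max (dist x y + dist z w) (dist x w + dist z y) :=
    four_point hd x z y w
  rw [dist_comm z y] at h
  rw [sub_zero, ge_iff_le, min_le_iff]
  rcases le_max_iff.mp h with h | h
  · left; linarith
  · right; linarith

section Action

variable {G : Type} [Group G] [MulAction G V]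

theorem exists_near (hd : IsTreeMetric d) (f g : TightSpan d) (h : 1 ≤ sdist f g) :
    ∃ p, f p ≤ 1 := by
  obtain ⟨a, b, hab⟩ := f.exists_far hd g one_pos
  have hfa : 0 ≤ f a := by
    have := f.le_add a a
    rw [hd.self] at this
    push_cast at this
    linarith
  have hgb : 0 ≤ g b := by
    have := g.le_add b b
    rw [hd.self] at this
    push_cast at this
    linarith
  have h1 := Nat.floor_le hfa
  have h2 := Nat.lt_floor_add_one (f a)
  obtain ⟨p, hp, hp'⟩ := hd.between a b ⌊f a⌋₊ (by
    have : (⌊f a⌋₊ : ℝ) ≤ d a b := by linarith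
    exact mod_cast this)
  refine ⟨p, ?_⟩
  have h3 := four_point hd f (vertex hd p) (vertex hd a) (vertex hd b)
  rw [sdist_vertex, sdist_vertex, sdist_vertex, sdist_vertex, sdist_vertex, sdist_vertex] at h3
  rw [vertex_apply, vertex_apply, vertex_apply, hd.symm b a, hd.symm b p] at h3
  have h4 := f.le_add_sdist hd g b
  rw [← hp'] at h3 hab
  rw [hp] at h3
  push_cast at h3 hab
  rcases le_max_iff.mp h3 with h5 | h5 <;> linarith

theorem goodAcylAction (hd : IsTreeMetric d) (hG : ∀ (g : G) x y, d (g • x) (g • y) = d x y) (k : ℕ)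
    (hk : ∀ (g : G) x y, d x y = k → g • x = x → g • y = y → g = 1) (o : V)
    (ho : ∀ N, ∃ g : G, N < d o (g • o)) :
    @GoodAcylAction G _ (TightSpan d) (metricSpace d hd) (act hG) := by
  let := metricSpace d hd
  have hdist : ∀ f g : TightSpan d, dist f g = sdist f g := fun _ _ => rfl
  refine ⟨fun g => Isometry.of_dist_eq (sdist_act hG g), fun f => coe_injective fun x => ?_,
    fun g h f => coe_injective fun x => ?_, isGeodesicSpace hd, isGromovHyperbolic hd, ?_,
    vertex hd o, ?_⟩
  · simp [act]
  · simp [act, mul_smul]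
  · intro r hr
    set R : ℕ := ⌈r⌉₊ + 2 with hR
    have hrR : r + 2 ≤ R := by
      rw [hR]
      push_cast
      have := Nat.le_ceil r
      linarith
    refine ⟨2 * R + k + 2, 2 * R + 1, by positivity, fun f g hfg => ?_⟩
    rw [hdist] at hfg
    have hR0 : (0 : ℝ) ≤ R := Nat.cast_nonneg _
    have hk0 : (0 : ℝ) ≤ k := Nat.cast_nonneg _
    obtain ⟨p, hp⟩ := exists_near hd f g (by linarith)
    obtain ⟨q, hq⟩ := exists_near hd g f (by rw [sdist_comm]; linarith)
    have hpq : 2 * R + k ≤ d p q := by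
      have h1 := dist_triangle f (vertex hd p) g
      have h2 := dist_triangle (vertex hd p) (vertex hd q) g
      rw [hdist, hdist, hdist, sdist_vertex] at h1
      rw [hdist, hdist, hdist, sdist_vertex, vertex_sdist, vertex_sdist, vertex_apply,
        hd.symm q p] at h2
      rw [vertex_sdist] at h1
      have : (2 * R + k : ℝ) ≤ d p q := by linarith
      exact mod_cast this
    have key : ∀ (h : G) (f : TightSpan d) (p : V), f p ≤ 1 → dist f (act hG h f) ≤ r →
        d p (h • p) ≤ R := by
      intro h f p hp hf
      rw [hdist] at hf
      have h1 := f.le_add_sdist hd (act hG h f) (h • p)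
      rw [act_apply, inv_smul_smul, sdist_comm] at h1
      have h2 := f.le_add p (h • p)
      have h3 : (d p (h • p) : ℝ) ≤ R := by
        rw [sdist_comm] at hf
        linarith
      exact mod_cast h3
    obtain ⟨hfin, hcard⟩ := hd.finite_of_far hG k hk R hpq
    have hsub : {h : G | dist f (act hG h f) ≤ r ∧ dist g (act hG h g) ≤ r} ⊆
        {h : G | d p (h • p) ≤ R ∧ d q (h • q) ≤ R} :=
      fun h hh => ⟨key h f p hp hh.1, key h g q hq hh.2⟩
    exact ⟨hfin.subset hsub, (Set.ncard_le_ncard hsub hfin).trans hcard⟩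
  · intro hb
    obtain ⟨C, hC⟩ := Metric.isBounded_iff.mp hb
    obtain ⟨g, hg⟩ := ho ⌈C⌉₊
    have h1 := hC (Set.mem_range_self 1) (Set.mem_range_self g)
    rw [hdist] at h1
    have h2 := (act hG g (vertex hd o)).le_add_sdist hd (act hG 1 (vertex hd o)) o
    rw [sdist_comm] at h2
    rw [act_apply, act_apply, vertex_apply, vertex_apply, inv_one, one_smul, hd.self,
      hd.symm] at h2
    have h3 : d o (g⁻¹ • o) = d o (g • o) := by
      rw [← hG g, smul_inv_smul, hd.symm]
    rw [h3] at h2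
    have h4 : (⌈C⌉₊ : ℝ) < d o (g • o) := mod_cast hg
    have h5 := Nat.le_ceil C
    push_cast at h2
    linarith

end Action

end TightSpan

/-- Nonempty alternating words with letters in `S true` and `S false`; the two Booleans are the
types of the first and of the last letter. -/
inductive AltWord {G : Type*} [Group G] (S : Bool → Set G) : Bool → Bool → G → Prop
  | single {i : Bool} {g : G} : g ∈ S i → AltWord S i i g
  | cons {i j : Bool} {g h : G} : g ∈ S i → AltWord S (!i) j h → AltWord S i j (g * h)

namespace AltWord

variable {G : Type*} [Group G] {S : Bool → Set G} {i j : Bool} {u : G}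

theorem map {G' : Type*} [Group G'] {S' : Bool → Set G'} (f : G →* G')
    (hf : ∀ i, ∀ g ∈ S i, f g ∈ S' i) (h : AltWord S i j u) : AltWord S' i j (f u) := by
  induction h with
  | single h => exact single (hf _ _ h)
  | cons h _ ih => rw [map_mul]; exact cons (hf _ _ h) ih

theorem mono {S' : Bool → Set G} (hS : ∀ i, S i ⊆ S' i) (h : AltWord S i j u) : AltWord S' i j u :=
  h.map (MonoidHom.id G) fun i _ hg => hS i hg

theorem snoc {l : G} (h : AltWord S i j u) (hl : l ∈ S (!j)) : AltWord S i (!j) (u * l) := by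
  induction h with
  | single h => exact cons h (single hl)
  | cons h _ ih => rw [mul_assoc]; exact cons h (ih hl)

theorem eq_snoc (h : AltWord S i j u) :
    (i = j ∧ u ∈ S j) ∨ ∃ v l, AltWord S i (!j) v ∧ l ∈ S j ∧ u = v * l := by
  induction h with
  | single h => exact Or.inl ⟨rfl, h⟩
  | @cons i j g h hg _ ih =>
    right
    rcases ih with ⟨rfl, hl⟩ | ⟨v, l, hv, hl, rfl⟩
    · exact ⟨g, h, by simpa using single hg, hl, rfl⟩
    · exact ⟨g * v, l, cons hg hv, hl, (mul_assoc _ _ _).symm⟩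

theorem inv (hS : ∀ i, ∀ g ∈ S i, g⁻¹ ∈ S i) (h : AltWord S i j u) : AltWord S j i u⁻¹ := by
  induction h with
  | single h => exact single (hS _ _ h)
  | @cons i j g h hg _ ih =>
    rw [mul_inv_rev]
    simpa using ih.snoc (l := g⁻¹) (by simpa using hS _ _ hg)

theorem mul_right {m : G} (hm : ∀ i, ∀ g ∈ S i, g * m ∈ S i) (h : AltWord S i j u) :
    AltWord S i j (u * m) := by
  induction h with
  | single h => exact single (hm _ _ h)
  | cons h _ ih => rw [mul_assoc]; exact cons h ih

/-- Elements of the subgroup generated by two subgroups are alternating products. -/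
theorem of_mem_sup {X : Bool → Subgroup G} (hu : u ∈ X true ⊔ X false) :
    u = 1 ∨ ∃ i j, AltWord (fun i => (X i : Set G) \ {1}) i j u := by
  have step : ∀ k, ∀ x ∈ X k, ∀ y, (y = 1 ∨ ∃ i j, AltWord (fun i => (X i : Set G) \ {1}) i j y) →
      (x * y = 1 ∨ ∃ i j, AltWord (fun i => (X i : Set G) \ {1}) i j (x * y)) := by
    intro k x hx y hy
    by_cases hx1 : x = 1
    · simpa [hx1] using hy
    rcases hy with rfl | ⟨i, j, hy⟩
    · exact Or.inr ⟨k, k, by simpa using single (S := fun i => (X i : Set G) \ {1}) ⟨hx, hx1⟩⟩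
    by_cases hik : i = k
    · subst hik
      cases hy with
      | single hg =>
        by_cases h1 : x * y = 1
        · exact Or.inl h1
        · exact Or.inr ⟨i, i, single ⟨mul_mem hx hg.1, h1⟩⟩
      | @cons _ _ g h hg hw =>
        rw [← mul_assoc]
        by_cases h1 : x * g = 1
        · exact Or.inr ⟨!i, j, by simpa [h1] using hw⟩
        · exact Or.inr ⟨i, j, cons ⟨mul_mem hx hg.1, h1⟩ hw⟩
    · have : i = !k := by revert hik; cases i <;> cases k <;> simp
      subst this
      exact Or.inr ⟨k, j, cons ⟨hx, hx1⟩ hy⟩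
  rw [Subgroup.sup_eq_closure] at hu
  induction hu using Subgroup.closure_induction_left with
  | one => exact Or.inl rfl
  | mul_left x hx y _ ih =>
    rcases hx with hx | hx
    · exact step true x hx y ih
    · exact step false x hx y ih
  | inv_mul_cancel x hx y _ ih =>
    rcases hx with hx | hx
    · exact step true x⁻¹ (inv_mem hx) y ih
    · exact step false x⁻¹ (inv_mem hx) y ih

end AltWord

/-- `G` is the amalgamated product of `M true` and `M false` over their intersection. -/
structure IsAmalgam {G : Type*} [Group G] (M : Bool → Subgroup G) : Prop where
  sup_eq_top : M true ⊔ M false = ⊤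
  ne_one : ∀ i j u, AltWord (fun i => (M i : Set G) \ M (!i)) i j u → u ≠ 1

namespace IsAmalgam

variable {G : Type*} [Group G] {M : Bool → Subgroup G} {i j : Bool} {u : G}

theorem notMem_not (hM : IsAmalgam M) (h : AltWord (fun i => (M i : Set G) \ M (!i)) i j u) :
    u ∉ M (!j) := by
  intro hu
  by_cases hu' : u ∈ M j
  · refine hM.ne_one i j (u * u⁻¹) (h.mul_right fun k g hg => ?_) (mul_inv_cancel u)
    have hk : ∀ k, u⁻¹ ∈ M k := by
      intro k
      rcases eq_or_ne k j with rfl | hk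
      · exact inv_mem hu'
      · have : k = !j := by revert hk; cases k <;> cases j <;> simp
        exact this ▸ inv_mem hu
    exact ⟨mul_mem hg.1 (hk _), fun h => hg.2 ((Subgroup.mul_mem_cancel_right _ (hk _)).mp h)⟩
  · refine hM.ne_one i (!j) (u * u⁻¹) (h.snoc ⟨inv_mem hu, fun h => hu' ?_⟩) (mul_inv_cancel u)
    simpa using h

theorem letter_inv (k : Bool) (g : G) (hg : g ∈ (M k : Set G) \ M (!k)) :
    g⁻¹ ∈ (M k : Set G) \ M (!k) :=
  ⟨inv_mem hg.1, fun h => hg.2 (by simpa using inv_mem h)⟩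

theorem eq_of_mem (hM : IsAmalgam M) (h : AltWord (fun i => (M i : Set G) \ M (!i)) i j u)
    {k : Bool} (hu : u ∈ M k) : i = k ∧ j = k ∧ u ∉ M (!k) := by
  have h1 : j = k := by
    by_contra hjk
    have : k = !j := by revert hjk; cases k <;> cases j <;> simp
    exact hM.notMem_not h (this ▸ hu)
  have h2 : i = k := by
    by_contra hjk
    have : k = !i := by revert hjk; cases k <;> cases i <;> simp
    exact hM.notMem_not (h.inv letter_inv) (this ▸ inv_mem hu)
  exact ⟨h2, h1, h1 ▸ hM.notMem_not h⟩

/-- The vertex set of the Bass-Serre tree. -/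
abbrev Vertex (M : Bool → Subgroup G) : Type _ := Σ b : Bool, G ⧸ M b

/-- The vertex `g M i` of the Bass-Serre tree. -/
def vtx (M : Bool → Subgroup G) (i : Bool) (g : G) : Vertex M := ⟨i, (g : G ⧸ M i)⟩

theorem smul_vtx (g h : G) : g • vtx M i h = vtx M i (g * h) := rfl

theorem vtx_eq {g h : G} : vtx M i g = vtx M j h ↔ i = j ∧ g⁻¹ * h ∈ M i := by
  constructor
  · intro e
    have hij : i = j := congrArg Sigma.fst e
    subst hij
    refine ⟨rfl, ?_⟩
    rw [← QuotientGroup.eq]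
    simpa [vtx] using e
  · rintro ⟨rfl, h⟩
    rw [← QuotientGroup.eq] at h
    simp [vtx, h]

theorem smul_vtx_eq {g h : G} : g • vtx M i h = vtx M i h ↔ h⁻¹ * g * h ∈ M i := by
  rw [smul_vtx, eq_comm, vtx_eq, mul_assoc]
  simp

theorem exists_vtx (v : Vertex M) : ∃ g, v = vtx M v.1 g := by
  obtain ⟨b, x⟩ := v
  obtain ⟨g, rfl⟩ := QuotientGroup.mk_surjective x
  exact ⟨g, rfl⟩

/-- The Bass-Serre tree. -/
def tree (M : Bool → Subgroup G) : SimpleGraph (Vertex M) where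
  Adj v w := ∃ i g, v = vtx M i g ∧ w = vtx M (!i) g
  symm := ⟨by rintro _ _ ⟨i, g, rfl, rfl⟩; exact ⟨!i, g, rfl, by simp⟩⟩
  loopless := ⟨by
    rintro _ ⟨i, g, rfl, h⟩
    rw [vtx_eq] at h
    simp at h⟩

theorem adj_vtx (i : Bool) (g : G) : (tree M).Adj (vtx M i g) (vtx M (!i) g) := ⟨i, g, rfl, rfl⟩

/-- Translation by a group element as an automorphism of the tree. -/
def treeIso (M : Bool → Subgroup G) (g : G) : tree M ≃g tree M where
  toEquiv := MulAction.toPerm g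
  map_rel_iff' := by
    have key : ∀ (g : G) (v w : Vertex M), (tree M).Adj v w → (tree M).Adj (g • v) (g • w) := by
      rintro g _ _ ⟨i, h, rfl, rfl⟩
      exact ⟨i, g * h, rfl, rfl⟩
    intro v w
    exact ⟨fun h => by simpa using key g⁻¹ _ _ h, key g v w⟩

theorem adj_smul (g : G) {v w : Vertex M} (h : (tree M).Adj v w) : (tree M).Adj (g • v) (g • w) :=
  (treeIso M g).map_adj_iff.mpr h

theorem connected (hM : IsAmalgam M) : (tree M).Connected := by
  have base : ∀ i j, (tree M).Reachable (vtx M i 1) (vtx M j 1) := by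
    intro i j
    rcases eq_or_ne j i with rfl | h
    · rfl
    · have : j = !i := by revert h; cases i <;> cases j <;> simp
      exact this ▸ (adj_vtx i 1).reachable
  have smul : ∀ (g : G) {v w}, (tree M).Reachable v w → (tree M).Reachable (g • v) (g • w) :=
    fun g v w h => h.map (treeIso M g).toHom
  have letter : ∀ k, ∀ x ∈ M k, ∀ i, (tree M).Reachable (vtx M i 1) (vtx M i x) := by
    intro k x hx i
    have h1 : vtx M k x = vtx M k 1 := by rw [vtx_eq]; simpa using hx
    have h2 := smul x (base k i)
    rw [smul_vtx, smul_vtx, mul_one, h1] at h2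
    exact (base i k).trans h2
  have all : ∀ g : G, ∀ i, (tree M).Reachable (vtx M i 1) (vtx M i g) := by
    intro g
    have hg : g ∈ M true ⊔ M false := hM.sup_eq_top ▸ Subgroup.mem_top g
    rw [Subgroup.sup_eq_closure] at hg
    induction hg using Subgroup.closure_induction_left with
    | one => intro i; rfl
    | mul_left x hx y _ ih =>
      intro i
      refine SimpleGraph.Reachable.trans ?_ (by simpa [smul_vtx] using smul x (ih i))
      rcases hx with hx | hx
      · exact letter true x hx i
      · exact letter false x hx i
    | inv_mul_cancel x hx y _ ih =>
      intro i
      refine SimpleGraph.Reachable.trans ?_ (by simpa [smul_vtx] using smul x⁻¹ (ih i))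
      rcases hx with hx | hx
      · exact letter true x⁻¹ (inv_mem hx) i
      · exact letter false x⁻¹ (inv_mem hx) i
  have : Nonempty (Vertex M) := ⟨vtx M true 1⟩
  refine ⟨fun v w => ?_⟩
  obtain ⟨g, hg⟩ := exists_vtx v
  obtain ⟨h, hh⟩ := exists_vtx w
  rw [hg, hh]
  exact (all g _).symm.trans ((base _ _).trans (all h _))

/-- Paths avoiding the base edge spell alternating words. -/
theorem word_of_reachable (i : Bool) {v : Vertex M}
    (h : ((tree M).deleteEdges {s(vtx M i 1, vtx M (!i) 1)}).Reachable (vtx M i 1) v) :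
    v = vtx M i 1 ∨ ∃ j g, v = vtx M j g ∧ AltWord (fun i => (M i : Set G) \ M (!i)) i (!j) g := by
  rw [SimpleGraph.reachable_iff_reflTransGen] at h
  induction h with
  | refl => exact Or.inl rfl
  | @tail v w _ hvw ih =>
    rw [SimpleGraph.deleteEdges_adj] at hvw
    obtain ⟨⟨k, x, hv, hw⟩, hne⟩ := hvw
    rcases ih with rfl | ⟨j, g, rfl, hg⟩
    · rw [vtx_eq] at hv
      obtain ⟨rfl, hx⟩ := hv
      simp only [inv_one, one_mul] at hx
      right
      refine ⟨!i, x, hw, ?_⟩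
      rw [Bool.not_not]
      refine AltWord.single ⟨hx, fun hx' => hne ?_⟩
      have : w = vtx M (!i) 1 := by
        rw [hw, vtx_eq]
        simpa using hx'
      rw [this]
      rfl
    · rw [vtx_eq] at hv
      obtain ⟨rfl, hx⟩ := hv
      obtain ⟨m, rfl⟩ : ∃ m, x = g * m := ⟨g⁻¹ * x, by simp⟩
      rw [inv_mul_cancel_left] at hx
      by_cases hm : m ∈ M (!j)
      · have hw' : w = vtx M (!j) g := by
          rw [hw, vtx_eq]
          simpa using hm
        rcases hg.eq_snoc with ⟨hij, hl⟩ | ⟨v, l, hv, hl, rfl⟩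
        · left
          rw [hw', ← hij, vtx_eq]
          rw [← hij] at hl
          exact ⟨rfl, by simpa using hl.1⟩
        · right
          refine ⟨!j, v, ?_, hv⟩
          rw [hw', vtx_eq]
          exact ⟨rfl, by simpa using hl.1⟩
      · right
        refine ⟨!j, g * m, hw, hg.snoc ?_⟩
        rw [Bool.not_not]
        exact ⟨hx, hm⟩

theorem isTree (hM : IsAmalgam M) : (tree M).IsTree := by
  refine ⟨hM.connected, ?_⟩
  rw [SimpleGraph.isAcyclic_iff_forall_adj_isBridge]
  rintro _ _ ⟨i, g, rfl, rfl⟩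
  rw [SimpleGraph.isBridge_iff]
  intro h
  have h' : ((tree M).deleteEdges {s(vtx M i 1, vtx M (!i) 1)}).Reachable
      (vtx M i 1) (vtx M (!i) 1) := by
    let φ : (tree M).deleteEdges {s(vtx M i g, vtx M (!i) g)} →g
        (tree M).deleteEdges {s(vtx M i 1, vtx M (!i) 1)} :=
      { toFun := fun v => g⁻¹ • v
        map_rel' := by
          intro v w hvw
          rw [SimpleGraph.deleteEdges_adj] at hvw ⊢
          refine ⟨adj_smul _ hvw.1, fun he => hvw.2 ?_⟩
          have := congrArg (Sym2.map fun v => g • v) (Set.mem_singleton_iff.mp he)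
          simpa [smul_vtx] using this }
    have := h.map φ
    simpa [φ, smul_vtx] using this
  rcases word_of_reachable i h' with h1 | ⟨j, u, h1, h2⟩
  · rw [vtx_eq] at h1
    simp at h1
  · rw [vtx_eq] at h1
    obtain ⟨rfl, h3⟩ := h1
    rw [Bool.not_not] at h2
    exact hM.notMem_not h2 (by simpa using h3)

theorem dist_smul (hM : IsAmalgam M) (g : G) (v w : Vertex M) :
    (tree M).dist (g • v) (g • w) = (tree M).dist v w := by
  have key : ∀ (g : G) (v w : Vertex M), (tree M).dist (g • v) (g • w) ≤ (tree M).dist v w := by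
    intro g v w
    obtain ⟨p, hp⟩ := hM.connected.exists_walk_length_eq_dist v w
    rw [← hp, ← SimpleGraph.Walk.length_map (treeIso M g).toHom p]
    exact SimpleGraph.dist_le _
  refine le_antisymm (key g v w) ?_
  simpa using key g⁻¹ (g • v) (g • w)

theorem even_dist (hM : IsAmalgam M) (g : G) (v : Vertex M) : Even ((tree M).dist v (g • v)) := by
  obtain ⟨p, hp⟩ := hM.connected.exists_walk_length_eq_dist v (g • v)
  rw [← hp]
  let c : (tree M).Coloring Bool := SimpleGraph.Coloring.mk (fun v => v.1) (by
    rintro _ _ ⟨i, g, rfl, rfl⟩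
    simp [vtx])
  rw [c.even_length_iff_congr p]
  rfl

/-- A condition that makes stabilisers of long segments trivial. -/
theorem eq_one_of_dist_eq (hM : IsAmalgam M)
    (hac : ∀ f ∈ M true, f ∈ M false → ∀ a ∈ M true, a ∉ M false → ∀ b ∈ M false, b ∉ M true →
      a⁻¹ * f * a ∈ M false → b⁻¹ * f * b ∈ M true → f = 1)
    (g : G) (v w : Vertex M) (h : (tree M).dist v w = 3) (hv : g • v = v) (hw : g • w = w) :
    g = 1 := by
  have hd := hM.isTree.isTreeMetric
  obtain ⟨p, hp⟩ := hM.connected.exists_walk_length_eq_dist v w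
  rw [h] at hp
  match p, hp with
  | .cons (v := x) h1 (.cons (v := y) h2 (.cons h3 .nil)), _ =>
    have d1 := SimpleGraph.dist_eq_one_iff_adj.mpr h1
    have d2 := SimpleGraph.dist_eq_one_iff_adj.mpr h2
    have d3 := SimpleGraph.dist_eq_one_iff_adj.mpr h3
    have t1 := hd.triangle v x w
    have t2 := hd.triangle v y w
    have t3 := hd.triangle x y w
    have t4 := hd.triangle v x y
    have hx : g • x = x := hd.smul_eq_of_between hM.dist_smul hv hw (by omega)
    have hy : g • y = y := hd.smul_eq_of_between hM.dist_smul hv hw (by omega)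
    have key : ∀ v x y w : Vertex M, (tree M).Adj v x → (tree M).Adj x y → (tree M).Adj y w →
        (tree M).dist v y = 2 → (tree M).dist x w = 2 → g • v = v → g • x = x → g • y = y →
        g • w = w → x.1 = true → g = 1 := by
      intro v x y w h1 h2 h3 d1 d2 hv hx hy hw hxt
      obtain ⟨i, u, rfl, rfl⟩ := h2
      obtain rfl : i = true := hxt
      obtain ⟨i, a, hxa, rfl⟩ := h1.symm
      rw [vtx_eq] at hxa
      obtain ⟨rfl, ha⟩ := hxa
      obtain ⟨i, b, hyb, rfl⟩ := h3
      rw [vtx_eq] at hyb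
      obtain ⟨rfl, hb⟩ := hyb
      obtain ⟨a, rfl⟩ : ∃ m, a = u * m := ⟨u⁻¹ * a, by simp⟩
      obtain ⟨b, rfl⟩ : ∃ m, b = u * m := ⟨u⁻¹ * b, by simp⟩
      rw [inv_mul_cancel_left] at ha hb
      simp only [Bool.not_true, Bool.not_false] at *
      rw [smul_vtx_eq] at hv hx hy hw
      have ha' : a ∉ M false := by
        intro h
        rw [(vtx_eq (i := false) (j := false) (g := u * a) (h := u)).mpr
          ⟨rfl, by simpa using h⟩, SimpleGraph.dist_self] at d1
        omega
      have hb' : b ∉ M true := by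
        intro h
        rw [vtx_eq (i := true) (j := true) (g := u) (h := u * b) |>.mpr ⟨rfl, by simpa using h⟩,
          SimpleGraph.dist_self] at d2
        omega
      have := hac _ hx hy a ha ha' b hb hb' (by simpa [mul_assoc] using hv)
        (by simpa [mul_assoc] using hw)
      simpa [mul_assoc, inv_mul_eq_one] using this
    cases hxt : x.1
    · refine key w y x v h3.symm h2.symm h1.symm ?_ ?_ hw hy hx hv ?_
      · rw [hd.symm]; omega
      · rw [hd.symm]; omega
      · obtain ⟨i, u, rfl, rfl⟩ := h2
        simp only [vtx] at hxt ⊢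
        simp [hxt]
    · exact key v x y w h1 h2 h3 (by omega) (by omega) hv hx hy hw hxt

open Monoid

section Pushout

variable {K : Bool → Type} [∀ i, Group (K i)] {H G : Type} [Group H] [Group G]
  {φ : ∀ i, H →* K i} {p : ∀ i, K i →* G} {c : H →* G}

theorem of_pushout_aux (hφ : ∀ i, Function.Injective (φ i)) (hc : ∀ i, (p i).comp (φ i) = c)
    (hsup : (p true).range ⊔ (p false).range = ⊤)
    (hθ : ∃ θ : G →* PushoutI φ, ∀ i, θ.comp (p i) = PushoutI.of i) :
    IsAmalgam (fun i => (p i).range) ∧ (∀ i, Function.Injective (p i)) ∧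
      (p true).range ⊓ (p false).range = c.range := by
  obtain ⟨θ, hθ⟩ := hθ
  have hθ' : ∀ i x, θ (p i x) = PushoutI.of i x := fun i x => DFunLike.congr_fun (hθ i) x
  have hc' : ∀ i x, p i (φ i x) = c x := fun i x => DFunLike.congr_fun (hc i) x
  have hinj : ∀ i, Function.Injective (p i) := by
    intro i x y hxy
    refine PushoutI.of_injective hφ i ?_
    rw [← hθ', ← hθ', hxy]
  refine ⟨⟨hsup, fun i j u hu h1 => ?_⟩, hinj, le_antisymm ?_ ?_⟩
  · suffices h : ∃ w : CoprodI.Word K, w.fstIdx = some i ∧ PushoutI.Reduced φ w ∧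
        PushoutI.ofCoprodI w.prod = θ u by
      obtain ⟨w, hw1, hw2, hw3⟩ := h
      have : w = .empty := hw2.eq_empty_of_mem_range hφ (by
        rw [hw3, h1, map_one]
        exact one_mem _)
      rw [this] at hw1
      simp [CoprodI.Word.fstIdx] at hw1
    have letter : ∀ i, ∀ g ∈ ((p i).range : Set G) \ (p (!i)).range,
        ∃ x, p i x = g ∧ x ∉ (φ i).range := by
      rintro i _ ⟨⟨x, rfl⟩, hx⟩
      refine ⟨x, rfl, ?_⟩
      rintro ⟨h, rfl⟩
      exact hx ⟨φ _ h, by rw [hc', hc']⟩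
    have cons : ∀ (i) (x : K i) (_ : x ∉ (φ i).range) (w : CoprodI.Word K),
        w.fstIdx ≠ some i → PushoutI.Reduced φ w →
        ∃ w' : CoprodI.Word K, w'.fstIdx = some i ∧ PushoutI.Reduced φ w' ∧
        PushoutI.ofCoprodI (φ := φ) w'.prod = PushoutI.of i x * PushoutI.ofCoprodI w.prod := by
      intro i x hx w hw hr
      have hx1 : x ≠ 1 := by
        rintro rfl
        exact hx (one_mem _)
      refine ⟨CoprodI.Word.cons x w hw hx1, by simp, ?_, ?_⟩
      · intro g hg
        simp only [CoprodI.Word.cons, List.mem_cons] at hg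
        rcases hg with rfl | hg
        · exact hx
        · exact hr g hg
      · rw [CoprodI.Word.prod_cons, map_mul, PushoutI.ofCoprodI_of]
    clear h1
    induction hu with
    | single hg =>
      obtain ⟨x, rfl, hx⟩ := letter _ _ hg
      obtain ⟨w, h1, h2, h3⟩ := cons _ x hx .empty (by simp [CoprodI.Word.fstIdx])
        (by intro g hg; simp [CoprodI.Word.empty] at hg)
      exact ⟨w, h1, h2, by rw [h3, hθ']; simp⟩
    | @cons i j g h hg _ ih =>
      obtain ⟨x, rfl, hx⟩ := letter _ _ hg
      obtain ⟨w, h1, h2, h3⟩ := ih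
      obtain ⟨w', h1', h2', h3'⟩ := cons _ x hx w (by simp [h1]) h2
      exact ⟨w', h1', h2', by rw [h3', h3, map_mul, hθ']⟩
  · rintro g ⟨⟨x, hx⟩, ⟨y, hy⟩⟩
    have h1 : PushoutI.of (φ := φ) true x ∈ (PushoutI.of (φ := φ) true).range ⊓
        (PushoutI.of (φ := φ) false).range :=
      ⟨⟨x, rfl⟩, ⟨y, by rw [← hθ', ← hθ', hx, hy]⟩⟩
    rw [PushoutI.inf_of_range_eq_base_range hφ (by simp)] at h1
    obtain ⟨h, hh⟩ := h1
    rw [← PushoutI.of_apply_eq_base φ true] at hh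
    exact ⟨h, by rw [← hc' true, PushoutI.of_injective hφ true hh, hx]⟩
  · rintro _ ⟨h, rfl⟩
    exact ⟨⟨φ true h, hc' _ _⟩, ⟨φ false h, hc' _ _⟩⟩

end Pushout

/-- The two-element family of groups with the given members. -/
def Pair (X Y : Type) : Bool → Type
  | true => X
  | false => Y

instance (X Y : Type) [Group X] [Group Y] : ∀ i, Group (Pair X Y i)
  | true => inferInstanceAs (Group X)
  | false => inferInstanceAs (Group Y)

/-- A group with the universal property of a pushout along injections is an amalgam. -/
theorem of_pushout {X Y H G : Type} [Group X] [Group Y] [Group H] [Group G] {α : H →* X}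
    {β : H →* Y} {p : X →* G} {q : Y →* G} (hα : Function.Injective α) (hβ : Function.Injective β)
    (hc : ∀ h, p (α h) = q (β h)) (hsup : p.range ⊔ q.range = ⊤)
    (hlift : ∀ (L : Type) [Group L] (φ : X →* L) (ψ : Y →* L), (∀ h, φ (α h) = ψ (β h)) →
      ∃ θ : G →* L, (∀ x, θ (p x) = φ x) ∧ ∀ y, θ (q y) = ψ y) :
    IsAmalgam (fun i => bif i then p.range else q.range) ∧ Function.Injective p ∧
      Function.Injective q ∧ p.range ⊓ q.range = (p.comp α).range := by
  let φ : ∀ i, H →* Pair X Y i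
    | true => α
    | false => β
  let r : ∀ i, Pair X Y i →* G
    | true => p
    | false => q
  have h := of_pushout_aux (φ := φ) (p := r) (c := p.comp α)
    (by rintro (_ | _); exacts [hβ, hα])
    (by
      rintro (_ | _)
      · ext h; exact (hc h).symm
      · rfl) hsup
    (by
      obtain ⟨θ, h1, h2⟩ := hlift (PushoutI φ) (PushoutI.of (φ := φ) true)
        (PushoutI.of (φ := φ) false) (fun h => by
          have h1 := PushoutI.of_apply_eq_base φ true h
          have h2 := PushoutI.of_apply_eq_base φ false h
          exact h1.trans h2.symm)
      refine ⟨θ, ?_⟩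
      rintro (_ | _)
      · ext y; exact h2 y
      · ext x; exact h1 x)
  have e : (fun i => (r i).range) = fun i => bif i then p.range else q.range := by
    funext i
    cases i <;> rfl
  exact ⟨e ▸ h.1, h.2.1 true, h.2.1 false, h.2.2⟩

end IsAmalgam

theorem isCyclic_of_isVirtuallyCyclic {G : Type*} [Group G]
    (htf : ∀ (g : G) (n : ℕ), 0 < n → g ^ n = 1 → g = 1) (h : IsVirtuallyCyclic G) :
    IsCyclic G := by
  obtain ⟨H, hH, hfin⟩ := h
  have hN : IsCyclic H.normalCore :=
    isCyclic_of_injective (Subgroup.inclusion H.normalCore_le) (Subgroup.inclusion_injective _)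
  set N := H.normalCore
  obtain ⟨c, hc⟩ := hN.exists_generator
  have hidx : 0 < N.index := Nat.pos_of_ne_zero Subgroup.FiniteIndex.index_ne_zero
  have hcomm : ∀ x ∈ N, ∀ y ∈ N, x * y = y * x := by
    intro x hx y hy
    have := (IsCyclic.commGroup (α := N)).mul_comm ⟨x, hx⟩ ⟨y, hy⟩
    exact congrArg Subtype.val this
  have htf' : ∀ (g : G) (m : ℤ), m ≠ 0 → g ^ m = 1 → g = 1 := by
    intro g m hm hg
    refine htf g m.natAbs (Int.natAbs_pos.mpr hm) ?_
    rcases Int.natAbs_eq m with h | h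
    · rw [h] at hg
      exact_mod_cast hg
    · rw [h, zpow_neg, inv_eq_one] at hg
      exact_mod_cast hg
  have hcen : N ≤ Subgroup.center G := by
    have h1 : ∀ g : G, g * c * g⁻¹ = c := by
      intro g
      by_cases hg : g = 1
      · simp [hg]
      have hz := N.pow_index_mem g
      obtain ⟨m, hm⟩ := hc ⟨_, hz⟩
      have hm' : (c : G) ^ m = g ^ N.index := by
        have := congrArg Subtype.val hm
        simpa using this
      have hm0 : m ≠ 0 := by
        rintro rfl
        exact hg (htf g _ hidx (by rw [← hm', zpow_zero]))
      have hc' : g * c * g⁻¹ ∈ N := (Subgroup.normalCore_normal H).conj_mem _ c.2 g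
      have h2 : (g * c * g⁻¹) ^ m = (c : G) ^ m := by
        rw [conj_zpow, hm', ← pow_succ', pow_succ, mul_inv_cancel_right]
      have h3 : ((g * c * g⁻¹) * (c : G)⁻¹) ^ m = 1 := by
        rw [(show Commute (g * c * g⁻¹) (c : G)⁻¹ from
          hcomm _ hc' _ (inv_mem c.2)).mul_zpow, h2, inv_zpow, mul_inv_cancel]
      exact mul_inv_eq_one.mp (htf' _ m hm0 h3)
    intro x hx
    obtain ⟨m, hm⟩ := hc ⟨x, hx⟩
    have hm' : (c : G) ^ m = x := by
      have := congrArg Subtype.val hm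
      simpa using this
    rw [Subgroup.mem_center_iff]
    intro g
    rw [← mul_inv_eq_iff_eq_mul, ← hm', ← conj_zpow, h1]
  have hfc : (Subgroup.center G).FiniteIndex := Subgroup.finiteIndex_of_le hcen
  have hinj : Function.Injective (MonoidHom.transferCenterPow G) := by
    rw [injective_iff_map_eq_one]
    intro g hg
    refine htf g _ (Nat.pos_of_ne_zero hfc.index_ne_zero) ?_
    rw [← MonoidHom.transferCenterPow_apply, hg]
    rfl
  have hab : ∀ a b : G, a * b = b * a := by
    intro a b
    apply hinj
    rw [map_mul, map_mul]
    ext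
    exact (Subgroup.mem_center_iff.mp (MonoidHom.transferCenterPow G b).2 _)
  let f : G →* N := MonoidHom.mk' (fun g => ⟨g ^ N.index, N.pow_index_mem g⟩) (fun a b => by
    ext
    exact (show Commute a b from hab a b).mul_pow _)
  refine isCyclic_of_injective f ?_
  rw [injective_iff_map_eq_one]
  intro g hg
  exact htf g _ hidx (congrArg Subtype.val hg)

/-- The strong Tits alternative, together with torsion-freeness, for all groups embedding in `G`. -/
def StrongTits (G : Type) [Group G] : Prop :=
  ∀ (H : Type) [Group H] (f : H →* G), Function.Injective f →
    (∀ (h : H) (n : ℕ), 0 < n → h ^ n = 1 → h = 1) ∧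
    (IsCyclic H ∨ (∃ f : H →* BS12, Function.Injective f) ∨ IsAcylindricallyHyperbolic H)

namespace StrongTits

theorem of_injective {G G' : Type} [Group G] [Group G'] (h : StrongTits G') (f : G →* G')
    (hf : Function.Injective f) : StrongTits G :=
  fun H _ g hg => h H (f.comp g) (hf.comp hg)

/-- The strong Tits alternative passes to amalgams with acylindrical Bass-Serre tree. -/
theorem of_isAmalgam {G : Type} [Group G] {M : Bool → Subgroup G} (hM : IsAmalgam M)
    (hac : ∀ f ∈ M true, f ∈ M false → ∀ a ∈ M true, a ∉ M false → ∀ b ∈ M false, b ∉ M true →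
      a⁻¹ * f * a ∈ M false → b⁻¹ * f * b ∈ M true → f = 1)
    (hV : ∀ i, StrongTits (M i)) : StrongTits G := by
  classical
  have hd := hM.isTree.isTreeMetric
  have bounded : ∀ (H : Type) [Group H] (f : H →* G), Function.Injective f → ∀ N : ℕ,
      (∀ h, (IsAmalgam.tree M).dist (IsAmalgam.vtx M true 1) (f h • IsAmalgam.vtx M true 1) ≤ N) →
      ∃ i, ∃ f' : H →* M i, Function.Injective f' := by
    intro H _ f hf N hN
    let : MulAction H (IsAmalgam.Vertex M) := MulAction.compHom _ f
    obtain ⟨c, hc, -⟩ := hd.exists_fixed (G := H) (fun h => hM.dist_smul (f h))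
      (IsAmalgam.vtx M true 1) (fun h => hM.even_dist (f h) _) N hN
    obtain ⟨g, hg⟩ := IsAmalgam.exists_vtx c
    refine ⟨c.1, ((MulAut.conj g⁻¹).toMonoidHom.comp f).codRestrict (M c.1) fun h => ?_, ?_⟩
    · have h1 : f h • c = c := hc h
      rw [hg, IsAmalgam.smul_vtx_eq] at h1
      simpa using h1
    · intro x y hxy
      have := congrArg Subtype.val hxy
      exact hf ((MulAut.conj g⁻¹).injective this)
  have htf : ∀ (g : G) (n : ℕ), 0 < n → g ^ n = 1 → g = 1 := by
    intro g n hn hg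
    set o := IsAmalgam.vtx M true 1
    have hord : IsOfFinOrder g := isOfFinOrder_iff_pow_eq_one.mpr ⟨n, hn, hg⟩
    have hfin : Finite (Subgroup.zpowers g) := by
      exact (finite_zpowers.mpr hord).to_subtype
    obtain ⟨N, hN⟩ := (Set.finite_range fun h : Subgroup.zpowers g =>
      (IsAmalgam.tree M).dist o ((h : G) • o)).bddAbove
    obtain ⟨i, f', hf'⟩ := bounded (Subgroup.zpowers g) (Subgroup.subtype _)
      (Subgroup.subtype_injective _) N (fun h => hN (Set.mem_range_self h))
    have := (hV i _ f' hf').1 ⟨g, Subgroup.mem_zpowers g⟩ n hn (by ext; simpa using hg)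
    exact congrArg Subtype.val this
  intro H _ f hf
  have htfH : ∀ (h : H) (n : ℕ), 0 < n → h ^ n = 1 → h = 1 := by
    intro h n hn hh
    apply hf
    rw [map_one]
    exact htf _ n hn (by rw [← map_pow, hh, map_one])
  refine ⟨htfH, ?_⟩
  by_cases hb : ∃ N : ℕ, ∀ h, (IsAmalgam.tree M).dist (IsAmalgam.vtx M true 1)
      (f h • IsAmalgam.vtx M true 1) ≤ N
  · obtain ⟨N, hN⟩ := hb
    obtain ⟨i, f', hf'⟩ := bounded H f hf N hN
    exact (hV i H f' hf').2
  push Not at hb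
  by_cases hvc : IsVirtuallyCyclic H
  · exact Or.inl (isCyclic_of_isVirtuallyCyclic htfH hvc)
  refine Or.inr (Or.inr ⟨hvc, ?_⟩)
  let : MulAction H (IsAmalgam.Vertex M) := MulAction.compHom _ f
  have : Nonempty (IsAmalgam.Vertex M) := ⟨IsAmalgam.vtx M true 1⟩
  have hG : ∀ (h : H) (x y : IsAmalgam.Vertex M),
      (IsAmalgam.tree M).dist (h • x) (h • y) = (IsAmalgam.tree M).dist x y :=
    fun h => hM.dist_smul (f h)
  refine ⟨_, TightSpan.metricSpace _ hd, TightSpan.act hG, TightSpan.goodAcylAction hd hG 3 ?_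
    (IsAmalgam.vtx M true 1) hb⟩
  intro h x y hxy hx hy
  apply hf
  rw [map_one]
  exact hM.eq_one_of_dist_eq hac (f h) x y hxy hx hy

end StrongTits

namespace BS12

/-- The stable letter of `BS(1,2)`. -/
def s : BS12 := PresentedGroup.of 0

/-- The base generator of `BS(1,2)`. -/
def t : BS12 := PresentedGroup.of 1

theorem s_mul_t : s * t * s⁻¹ = t ^ 2 := by
  have h : PresentedGroup.mk bsRels
      (FreeGroup.of 0 * FreeGroup.of 1 * (FreeGroup.of 0)⁻¹ * ((FreeGroup.of 1)⁻¹) ^ 2) = 1 :=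
    PresentedGroup.one_of_mem rfl
  simp only [map_mul, map_inv, map_pow] at h
  rw [inv_pow, mul_inv_eq_one] at h
  exact h

/-- The homomorphism out of `BS(1,2)` determined by the images of the generators. -/
def lift {L : Type*} [Group L] (x y : L) (h : x * y * x⁻¹ = y ^ 2) : BS12 →* L :=
  PresentedGroup.toGroup (f := ![x, y]) (by
    rintro _ rfl
    simp [h])

section Lift

variable {L : Type*} [Group L] (x y : L) (h : x * y * x⁻¹ = y ^ 2)

@[simp]
theorem lift_s : lift x y h s = x := PresentedGroup.toGroup.of _

@[simp]
theorem lift_t : lift x y h t = y := PresentedGroup.toGroup.of _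

end Lift

theorem closure_eq_top : Subgroup.closure {s, t} = ⊤ := by
  rw [eq_top_iff, ← PresentedGroup.closure_range_of, Subgroup.closure_le]
  rintro _ ⟨i, rfl⟩
  fin_cases i
  · exact Subgroup.subset_closure (by simp [s])
  · exact Subgroup.subset_closure (by simp [t])

/-- The exponent sum of `s`. -/
def expo : BS12 →* Multiplicative ℤ := lift (Multiplicative.ofAdd 1) 1 (by simp)

/-- The affine action of `BS(1,2)` on the rationals. -/
def affine : BS12 →* Equiv.Perm ℚ :=
  lift (Equiv.mulLeft₀ 2 two_ne_zero) (Equiv.addRight 1) (by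
    ext x
    simp [pow_two]
    ring)

theorem expo_s_zpow (m : ℤ) : expo (s ^ m) = Multiplicative.ofAdd m := by
  rw [map_zpow, expo, lift_s, ← ofAdd_zsmul]
  simp

theorem expo_t_zpow (m : ℤ) : expo (t ^ m) = 1 := by
  rw [map_zpow, expo, lift_t, one_zpow]

theorem affine_t_zpow (m : ℤ) (x : ℚ) : affine (t ^ m) x = x + m := by
  rw [map_zpow, affine, lift_t]
  have h : ∀ n : ℕ, ∀ x : ℚ, (Equiv.addRight (1 : ℚ) ^ n) x = x + n := by
    intro n
    induction n with
    | zero => simp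
    | succ n ih =>
      intro x
      rw [pow_succ, Equiv.Perm.mul_apply, ih]
      simp
      ring
  obtain ⟨n, rfl | rfl⟩ := m.eq_nat_or_neg
  · rw [zpow_natCast, h, Int.cast_natCast]
  · rw [zpow_neg, Equiv.Perm.inv_eq_iff_eq, zpow_natCast, h]
    simp

theorem affine_s_zpow (m : ℤ) (x : ℚ) : affine (s ^ m) x = 2 ^ m * x := by
  have h : ∀ n : ℕ, ∀ x : ℚ, affine (s ^ n) x = 2 ^ n * x := by
    intro n
    induction n with
    | zero => simp
    | succ n ih =>
      intro x
      rw [pow_succ, map_mul, Equiv.Perm.mul_apply, ih, affine, lift_s, pow_succ]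
      simp
      ring
  obtain ⟨n, rfl | rfl⟩ := m.eq_nat_or_neg
  · rw [zpow_natCast, zpow_natCast, h]
  · rw [zpow_neg, map_inv, Equiv.Perm.inv_eq_iff_eq, zpow_natCast, h, zpow_neg, zpow_natCast]
    field_simp

theorem s_pow_mul_t_zpow (n : ℕ) (k : ℤ) : s ^ n * t ^ k * (s ^ n)⁻¹ = t ^ (2 ^ n * k) := by
  induction n generalizing k with
  | zero => simp
  | succ n ih =>
    have h1 : s * t ^ k * s⁻¹ = t ^ (2 * k) := by
      rw [← conj_zpow, s_mul_t, zpow_mul]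
      norm_cast
    calc s ^ (n + 1) * t ^ k * (s ^ (n + 1))⁻¹ = s ^ n * (s * t ^ k * s⁻¹) * (s ^ n)⁻¹ := by
          rw [pow_succ]; group
      _ = _ := by rw [h1, ih, pow_succ, mul_assoc]

theorem normal_form (g : BS12) : ∃ (i j : ℕ) (k : ℤ), g = (s ^ i)⁻¹ * t ^ k * s ^ j := by
  have hS : ∀ g : BS12, (∃ (i j : ℕ) (k : ℤ), g = (s ^ i)⁻¹ * t ^ k * s ^ j) →
      ∃ (i j : ℕ) (k : ℤ), s * g = (s ^ i)⁻¹ * t ^ k * s ^ j := by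
    rintro _ ⟨i, j, k, rfl⟩
    rcases i with _ | i
    · refine ⟨0, j + 1, 2 * k, ?_⟩
      have := s_pow_mul_t_zpow 1 k
      rw [pow_one, pow_one, mul_inv_eq_iff_eq_mul] at this
      simp only [pow_zero, inv_one, one_mul, pow_succ' s j]
      rw [← mul_assoc, this, mul_assoc]
    · refine ⟨i, j, k, ?_⟩
      rw [pow_succ]
      group
  have hS' : ∀ g : BS12, (∃ (i j : ℕ) (k : ℤ), g = (s ^ i)⁻¹ * t ^ k * s ^ j) →
      ∃ (i j : ℕ) (k : ℤ), s⁻¹ * g = (s ^ i)⁻¹ * t ^ k * s ^ j := by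
    rintro _ ⟨i, j, k, rfl⟩
    refine ⟨i + 1, j, k, ?_⟩
    rw [pow_succ]
    group
  have hT : ∀ (l : ℤ) (g : BS12), (∃ (i j : ℕ) (k : ℤ), g = (s ^ i)⁻¹ * t ^ k * s ^ j) →
      ∃ (i j : ℕ) (k : ℤ), t ^ l * g = (s ^ i)⁻¹ * t ^ k * s ^ j := by
    rintro l _ ⟨i, j, k, rfl⟩
    refine ⟨i, j, 2 ^ i * l + k, ?_⟩
    rw [zpow_add, ← s_pow_mul_t_zpow]
    group
  have hg : g ∈ Subgroup.closure {s, t} := closure_eq_top ▸ Subgroup.mem_top g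
  induction hg using Subgroup.closure_induction_left with
  | one => exact ⟨0, 0, 0, by simp⟩
  | mul_left x hx y _ ih =>
    rcases hx with rfl | rfl
    · exact hS y ih
    · simpa using hT 1 y ih
  | inv_mul_cancel x hx y _ ih =>
    rcases hx with rfl | rfl
    · exact hS' y ih
    · simpa using hT (-1) y ih

theorem t_zpow_eq_one {m : ℤ} (h : t ^ m = 1) : m = 0 := by
  have := affine_t_zpow m 0
  rw [h] at this
  simpa using this.symm

theorem s_zpow_eq_one {m : ℤ} (h : s ^ m = 1) : m = 0 := by
  have := expo_s_zpow m
  rw [h, map_one] at this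
  exact this.symm

theorem t_zpow_eq_s_zpow {k m : ℤ} (h : t ^ k = s ^ m) : t ^ k = 1 := by
  have h1 := congrArg expo h
  rw [expo_t_zpow, expo_s_zpow] at h1
  have h2 : m = 0 := h1.symm
  rw [h, h2, zpow_zero]

/-- The subgroup generated by `s` is malnormal. -/
theorem mem_zpowers_s {g : BS12} {m m' : ℤ} (hm : m ≠ 0) (h : g * s ^ m * g⁻¹ = s ^ m') :
    g ∈ Subgroup.zpowers s := by
  obtain ⟨i, j, k, rfl⟩ := normal_form g
  have h1 : t ^ k * s ^ m = s ^ m' * t ^ k := by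
    have h2 : (s ^ i)⁻¹ * (t ^ k * s ^ m * (t ^ k)⁻¹) * s ^ i = s ^ m' := by
      rw [← h]
      have h3 : s ^ m = s ^ j * s ^ m * (s ^ j)⁻¹ := by group
      conv_lhs => rw [h3]
      group
    have h4 : t ^ k * s ^ m * (t ^ k)⁻¹ = s ^ i * s ^ m' * (s ^ i)⁻¹ := by
      rw [← h2]; group
    rw [mul_inv_eq_iff_eq_mul] at h4
    rw [h4]
    group
  have h2 := congrArg expo h1
  rw [map_mul, map_mul, expo_t_zpow, expo_s_zpow, expo_s_zpow, one_mul, mul_one] at h2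
  obtain rfl : m = m' := h2
  have h3 := congrArg (fun g => affine g 0) h1
  simp only [map_mul, Equiv.Perm.mul_apply, affine_t_zpow, affine_s_zpow] at h3
  have h4 : (2 : ℚ) ^ m ≠ 1 := by
    rw [Ne, zpow_eq_one_iff_right₀ (by norm_num) (by norm_num)]
    exact hm
  have h5 : k = 0 := by
    by_contra hk
    have hk' : (k : ℚ) ≠ 0 := Int.cast_ne_zero.mpr hk
    apply h4
    have h6 : (2 : ℚ) ^ m * k = 1 * k := by linarith
    exact mul_right_cancel₀ hk' h6
  rw [h5, zpow_zero, mul_one]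
  exact mul_mem (inv_mem (Subgroup.npow_mem_zpowers s i)) (Subgroup.npow_mem_zpowers s j)

theorem torsion_free (g : BS12) (n : ℕ) (hn : 0 < n) (hg : g ^ n = 1) : g = 1 := by
  obtain ⟨i, j, k, rfl⟩ := normal_form g
  have h1 := congrArg expo hg
  have h2 : expo ((s ^ i)⁻¹ * t ^ k * s ^ j) = Multiplicative.ofAdd (-i + j : ℤ) := by
    rw [map_mul, map_mul, map_inv, expo_t_zpow, ← zpow_natCast, ← zpow_natCast, expo_s_zpow,
      expo_s_zpow, mul_one]
    rfl
  rw [map_pow, h2, map_one, ← ofAdd_nsmul, ofAdd_eq_one, nsmul_eq_mul, mul_eq_zero] at h1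
  have h3 : i = j := by
    rcases h1 with h1 | h1 <;> omega
  subst h3
  have h4 : (s ^ i)⁻¹ * t ^ k * s ^ i = (s ^ i)⁻¹ * t ^ k * ((s ^ i)⁻¹)⁻¹ := by simp
  rw [h4, conj_pow, conj_eq_one_iff, ← zpow_natCast, ← zpow_mul] at hg
  have := t_zpow_eq_one hg
  have : k = 0 := by
    rcases mul_eq_zero.mp this with h | h
    · exact h
    · omega
  simp [this]

theorem strongTits : StrongTits BS12 := by
  intro H _ f hf
  refine ⟨fun h n hn hh => hf ?_, Or.inr (Or.inl ⟨f, hf⟩)⟩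
  rw [map_one]
  exact torsion_free _ n hn (by rw [← map_pow, hh, map_one])

end BS12

namespace IsAmalgam

variable {G : Type*} [Group G] {M X : Bool → Subgroup G}

theorem even_dist_iff (hM : IsAmalgam M) (v w : Vertex M) :
    Even ((tree M).dist v w) ↔ v.1 = w.1 := by
  obtain ⟨p, hp⟩ := hM.connected.exists_walk_length_eq_dist v w
  rw [← hp]
  let c : (tree M).Coloring Bool := SimpleGraph.Coloring.mk (fun v => v.1) (by
    rintro _ _ ⟨i, g, rfl, rfl⟩
    simp [vtx])
  rw [c.even_length_iff_congr p]
  exact ⟨fun h => Bool.eq_iff_iff.mpr h, fun h => Bool.eq_iff_iff.mp h⟩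

/-- An element of a vertex group not conjugate into the edge group fixes only one vertex. -/
theorem eq_of_fixed (hM : IsAmalgam M) {i : Bool} {x : G} (hx : x ∈ M i)
    (hx' : ∀ p ∈ M i, p⁻¹ * x * p ∉ M (!i)) {v : Vertex M} (hv : x • v = v) : v = vtx M i 1 := by
  by_contra hne
  have hd := hM.isTree.isTreeMetric
  obtain ⟨w, hw, hwd⟩ := hM.connected.exists_adj_dist (Ne.symm hne)
  have h1 := SimpleGraph.dist_eq_one_iff_adj.mpr hw
  have h2 : x • w = w := hd.smul_eq_of_between hM.dist_smul (x := vtx M i 1) (y := v)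
    (by rw [smul_vtx_eq]; simpa using hx) hv (by omega)
  obtain ⟨j, g, hg, rfl⟩ := hw
  rw [vtx_eq] at hg
  obtain ⟨rfl, hg⟩ := hg
  rw [smul_vtx_eq] at h2
  exact hx' g (by simpa using hg) h2

/-- Subgroups of the vertex groups meeting the edge group trivially. -/
structure Transverse (M X : Bool → Subgroup G) : Prop where
  le : ∀ i, X i ≤ M i
  eq_one : ∀ i, ∀ x ∈ X i, x ∈ M (!i) → x = 1

namespace Transverse

theorem word (hX : Transverse M X) {i j : Bool} {u : G}
    (h : AltWord (fun i => (X i : Set G) \ {1}) i j u) :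
    AltWord (fun i => (M i : Set G) \ M (!i)) i j u :=
  h.mono fun i g hg => ⟨hX.le i hg.1, fun h => hg.2 (hX.eq_one i g hg.1 h)⟩

theorem mem_of_mem (hM : IsAmalgam M) (hX : Transverse M X) {u : G} (hu : u ∈ X true ⊔ X false)
    {k : Bool} (hk : u ∈ M k) : u ∈ X k := by
  rcases AltWord.of_mem_sup hu with rfl | ⟨i, j, h⟩
  · exact one_mem _
  · obtain ⟨rfl, rfl, -⟩ := hM.eq_of_mem (hX.word h) hk
    cases h with
    | single h => exact h.1
    | @cons _ _ x u hx h =>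
      have := (Subgroup.mul_mem_cancel_left _ (hX.le _ hx.1)).mp hk
      obtain ⟨h1, -⟩ := hM.eq_of_mem (hX.word h) this
      simp at h1

theorem mem_sup (i : Bool) {x : G} (hx : x ∈ X i) : x ∈ X true ⊔ X false := by
  cases i
  · exact Subgroup.mem_sup_right hx
  · exact Subgroup.mem_sup_left hx

theorem exists_mul (hM : IsAmalgam M) (hX : Transverse M X) {w : G} (hw : w ∈ X true ⊔ X false)
    {i : Bool} {m m' : G} (hm : m ∈ M i) (hm' : m' ∈ M (!i)) (hwm : w = m * m') :
    ∃ x ∈ X i, ∃ y ∈ X (!i), w = x * y := by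
  obtain ⟨x, hx, w', rfl, hw'⟩ : ∃ x ∈ X i, ∃ w', w = x * w' ∧
      (w' = 1 ∨ ∃ r, AltWord (fun i => (X i : Set G) \ {1}) (!i) r w') := by
    rcases AltWord.of_mem_sup hw with rfl | ⟨p, r, h⟩
    · exact ⟨1, one_mem _, 1, by simp, Or.inl rfl⟩
    · by_cases hp : p = i
      · subst hp
        cases h with
        | single h => exact ⟨w, h.1, 1, by simp, Or.inl rfl⟩
        | @cons _ _ x u hx h => exact ⟨x, hx.1, u, rfl, Or.inr ⟨r, h⟩⟩
      · have : p = !i := by revert hp; cases p <;> cases i <;> simp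
        exact ⟨1, one_mem _, w, by simp, Or.inr ⟨r, this ▸ h⟩⟩
  refine ⟨x, hx, w', ?_, rfl⟩
  rcases hw' with rfl | ⟨r, h⟩
  · exact one_mem _
  have hw'F : w' ∈ X true ⊔ X false :=
    (Subgroup.mul_mem_cancel_left _ (mem_sup i hx)).mp hw
  refine hX.mem_of_mem hM hw'F ?_
  have e : w' = (x⁻¹ * m) * m' := by rw [mul_assoc, ← hwm]; simp
  have hm1 : x⁻¹ * m ∈ M i := mul_mem (inv_mem (hX.le i hx)) hm
  by_cases hm2 : x⁻¹ * m ∈ M (!i)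
  · rw [e]
    exact mul_mem hm2 hm'
  · exfalso
    have h1 : AltWord (fun i => (M i : Set G) \ M (!i)) i r ((x⁻¹ * m)⁻¹ * w') :=
      .cons (letter_inv _ _ ⟨hm1, hm2⟩) (hX.word h)
    have h2 : (x⁻¹ * m)⁻¹ * w' ∈ M (!i) := by
      rw [e, inv_mul_cancel_left]
      exact hm'
    obtain ⟨h3, -⟩ := hM.eq_of_mem h1 h2
    simp at h3

/-- Adjacent vertices in the orbits of `⟨X⟩` are joined by an edge in the orbit of `⟨X⟩`. -/
theorem exists_edge (hM : IsAmalgam M) (hX : Transverse M X) {i j : Bool} {f g : G}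
    (hf : f ∈ X true ⊔ X false) (hg : g ∈ X true ⊔ X false)
    (h : (tree M).Adj (vtx M i f) (vtx M j g)) :
    ∃ u ∈ X true ⊔ X false, vtx M i f = vtx M i u ∧ vtx M j g = vtx M (!i) u := by
  obtain ⟨k, u, h1, h2⟩ := h
  rw [vtx_eq] at h1 h2
  obtain ⟨rfl, h1⟩ := h1
  obtain ⟨rfl, h2⟩ := h2
  obtain ⟨x, hx, y, hy, hxy⟩ := hX.exists_mul hM (mul_mem (inv_mem hf) hg) h1 (inv_mem h2)
    (by group)
  refine ⟨f * x, mul_mem hf (mem_sup _ hx), ?_, ?_⟩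
  · rw [vtx_eq]
    exact ⟨rfl, by simpa using hX.le _ hx⟩
  · rw [vtx_eq]
    refine ⟨rfl, ?_⟩
    have : g = f * (x * y) := by rw [← hxy]; group
    rw [this]
    have : (f * (x * y))⁻¹ * (f * x) = y⁻¹ := by group
    rw [this]
    exact inv_mem (hX.le _ hy)

/-- The vertices on a segment between translates of the base point under `⟨X⟩` lie in the orbits
of `⟨X⟩`. -/
theorem exists_vtx_of_between (hM : IsAmalgam M) (hX : Transverse M X) {f : G}
    (hf : f ∈ X true ⊔ X false) {c : Vertex M}
    (hc : (tree M).dist (vtx M true 1) c + (tree M).dist c (vtx M true f) =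
      (tree M).dist (vtx M true 1) (vtx M true f)) :
    ∃ i, ∃ u ∈ X true ⊔ X false, c = vtx M i u := by
  have hd := hM.isTree.isTreeMetric
  let r : Vertex M → Vertex M → Prop := fun v w =>
    ∃ i, ∃ u ∈ X true ⊔ X false, v = vtx M i u ∧ w = vtx M (!i) u
  have hr : ∀ v w, r v w → (tree M).dist v w = 1 := by
    rintro _ _ ⟨i, u, -, rfl, rfl⟩
    exact SimpleGraph.dist_eq_one_iff_adj.mpr (adj_vtx i u)
  have base : ∀ u ∈ X true ⊔ X false, ∀ i j,
      Relation.ReflTransGen r (vtx M i u) (vtx M j u) := by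
    intro u hu i j
    rcases eq_or_ne j i with rfl | h
    · rfl
    · have : j = !i := by revert h; cases i <;> cases j <;> simp
      exact this ▸ .single ⟨i, u, hu, rfl, rfl⟩
  have smul : ∀ g ∈ X true ⊔ X false, ∀ {v w}, Relation.ReflTransGen r v w →
      Relation.ReflTransGen r (g • v) (g • w) := by
    intro g hg v w h
    refine Relation.ReflTransGen.lift (p := r) (fun v => g • v) ?_ _ _ h
    rintro _ _ ⟨i, u, hu, rfl, rfl⟩
    exact ⟨i, g * u, mul_mem hg hu, rfl, rfl⟩
  have letter : ∀ k, ∀ x ∈ X k, ∀ i, Relation.ReflTransGen r (vtx M i 1) (vtx M i x) := by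
    intro k x hx i
    have h1 : vtx M k x = vtx M k 1 := by rw [vtx_eq]; simpa using hX.le k hx
    have h2 := smul x (mem_sup k hx) (base 1 (one_mem _) k i)
    rw [smul_vtx, smul_vtx, mul_one, h1] at h2
    exact (base 1 (one_mem _) i k).trans h2
  have step : ∀ k, ∀ x ∈ X k, ∀ y, Relation.ReflTransGen r (vtx M true 1) (vtx M true y) →
      Relation.ReflTransGen r (vtx M true 1) (vtx M true (x * y)) := by
    intro k x hx y hy
    refine (letter k x hx true).trans ?_
    simpa [smul_vtx] using smul x (mem_sup k hx) hy
  have all : Relation.ReflTransGen r (vtx M true 1) (vtx M true f) := by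
    clear hc
    rw [Subgroup.sup_eq_closure] at hf
    induction hf using Subgroup.closure_induction_left with
    | one => rfl
    | mul_left x hx y _ ih =>
      rcases hx with hx | hx
      · exact step true x hx y ih
      · exact step false x hx y ih
    | inv_mul_cancel x hx y _ ih =>
      rcases hx with hx | hx
      · exact step true x⁻¹ (inv_mem hx) y ih
      · exact step false x⁻¹ (inv_mem hx) y ih
  have hrc := hd.mem_of_chain hr all hc
  rcases hrc.cases_tail with h | ⟨v, -, i, u, hu, -, rfl⟩
  · exact ⟨true, 1, one_mem _, h⟩
  · exact ⟨_, u, hu, rfl⟩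

/-- Elliptic elements of `⟨X⟩` are conjugate in `⟨X⟩` into one of the factors. -/
theorem exists_conj_mem (hM : IsAmalgam M) (hX : Transverse M X) {f : G}
    (hf : f ∈ X true ⊔ X false) {N : ℕ}
    (hN : ∀ k : ℤ, (tree M).dist (vtx M true 1) (f ^ k • vtx M true 1) ≤ N) :
    ∃ u ∈ X true ⊔ X false, ∃ i, u⁻¹ * f * u ∈ X i := by
  have hd := hM.isTree.isTreeMetric
  obtain ⟨c, hc, ⟨g, k, rfl⟩, hgc⟩ := hd.exists_fixed (G := Subgroup.zpowers f)
    (fun g => hM.dist_smul (g : G)) (vtx M true 1) (fun g => hM.even_dist (g : G) _) N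
    (by rintro ⟨_, k, rfl⟩; exact hN k)
  have hcf : f • c = c := hc ⟨f, Subgroup.mem_zpowers f⟩
  obtain ⟨i, u, hu, rfl⟩ := hX.exists_vtx_of_between hM (zpow_mem hf k) (c := c) (by
    have h : vtx M true (f ^ k) = f ^ k • vtx M true 1 := by rw [smul_vtx, mul_one]
    rw [h]
    exact hgc)
  rw [smul_vtx_eq] at hcf
  exact ⟨u, hu, i, hX.mem_of_mem hM (mul_mem (mul_mem (inv_mem hu) hf) hu) hcf⟩

/-- Hyperbolic elements of `⟨X⟩` are conjugated into `⟨X⟩` only by elements of `⟨X⟩`. -/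
theorem mem_of_conj_mem (hM : IsAmalgam M) (hX : Transverse M X)
    (hZ : ∀ x ∈ X true, x ≠ 1 → ∀ x' ∈ X true, ∀ z, z ∈ M true → z ∈ M false →
      x'⁻¹ * z * x ∈ M false → z = 1)
    {f h : G} (hf : f ∈ X true ⊔ X false) (hfh : h * f * h⁻¹ ∈ X true ⊔ X false)
    (hN : ∀ N : ℕ, ∃ k : ℤ, N < (tree M).dist (vtx M true 1) (f ^ k • vtx M true 1)) :
    h ∈ X true ⊔ X false := by
  have hd := hM.isTree.isTreeMetric
  set d := (tree M).dist with hdd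
  set o := vtx M true 1 with ho
  set D := d o (h⁻¹ • o) with hD
  obtain ⟨k, hk⟩ := hN (4 * D + 10)
  set y := f ^ k • o with hy
  obtain ⟨p1, h1, h1'⟩ := hd.between o y (2 * (D + 1)) (by omega)
  have hp1 : p1.1 = true := by
    have := (hM.even_dist_iff o p1).mp (by rw [← hdd, h1]; exact even_two_mul _)
    exact this.symm
  have ty := hd.triangle o p1 y
  obtain ⟨p0, h0, h0'⟩ := hd.between o p1 (2 * D + 1) (by omega)
  obtain ⟨p2, h2, h2'⟩ := hd.between p1 y 1 (by omega)
  have b0 : d o p0 + d p0 y = d o y := by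
    have := hd.triangle o p0 y
    have := hd.triangle p0 p1 y
    omega
  have b2 : d o p2 + d p2 y = d o y := by
    have := hd.triangle o p1 p2
    have := hd.triangle o p2 y
    omega
  have d2 : d o p2 = 2 * D + 3 := by omega
  -- points on the segment are translates both under `⟨X⟩` and under `h⁻¹ ⟨X⟩`
  have yd : d (f ^ k • h⁻¹ • o) y = D := by
    rw [hy, hdd, hM.dist_smul, ← hdd, hd.symm]
  have hyo : y = vtx M true (f ^ k) := by rw [hy, ho, smul_vtx, mul_one]
  have two : ∀ p, d o p + d p y = d o y → D ≤ d o p → D ≤ d p y →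
      (∃ i, ∃ u ∈ X true ⊔ X false, p = vtx M i u) ∧
      (∃ i, ∃ u ∈ X true ⊔ X false, h • p = vtx M i u) := by
    intro p hp e1 e2
    refine ⟨hX.exists_vtx_of_between hM (zpow_mem hf k) (by rw [← hyo]; exact hp), ?_⟩
    have q1 : d (h⁻¹ • o) p + d p y = d (h⁻¹ • o) y :=
      hd.between_of_near hp (by rw [hd.symm]; omega)
    have s1 := hd.symm y p
    have s2 := hd.symm p (h⁻¹ • o)
    have s3 := hd.symm y (h⁻¹ • o)
    have s4 := hd.symm (f ^ k • h⁻¹ • o) p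
    have s5 := hd.symm (f ^ k • h⁻¹ • o) (h⁻¹ • o)
    have q2 : d (f ^ k • h⁻¹ • o) p + d p (h⁻¹ • o) = d (f ^ k • h⁻¹ • o) (h⁻¹ • o) :=
      hd.between_of_near (x := y) (by omega) (by omega)
    refine hX.exists_vtx_of_between hM (zpow_mem hfh k) ?_
    have e3 : o = h • h⁻¹ • o := by simp
    have e4 : vtx M true ((h * f * h⁻¹) ^ k) = h • f ^ k • h⁻¹ • o := by
      rw [ho, smul_vtx, smul_vtx, smul_vtx, conj_zpow]
      simp [mul_assoc]
    rw [e4, ← ho, e3, hM.dist_smul, hM.dist_smul, hM.dist_smul, ← hdd, smul_inv_smul]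
    omega
  have edge : ∀ p, d p1 p = 1 → d o p + d p y = d o y → D ≤ d o p → D ≤ d p y →
      ∃ u ∈ X true ⊔ X false, ∃ u' ∈ X true ⊔ X false, p1 = vtx M true u ∧ p = vtx M false u ∧
        h • p1 = vtx M true u' ∧ h • p = vtx M false u' := by
    intro p hp e1 e2 e3
    have hadj : (tree M).Adj p1 p := SimpleGraph.dist_eq_one_iff_adj.mp hp
    obtain ⟨⟨i, u1, hu1, r1⟩, ⟨i', u1', hu1', r1'⟩⟩ := two p1 (by omega) (by omega) (by omega)
    obtain ⟨⟨j, u2, hu2, r2⟩, ⟨j', u2', hu2', r2'⟩⟩ := two p e1 e2 e3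
    have hadj' := adj_smul h hadj
    have hi : i = true := by
      rw [← hp1, r1]; rfl
    have hi' : i' = true := by
      have : (h • p1).1 = true := hp1
      rw [← this, r1']; rfl
    subst hi hi'
    rw [r1, r2] at hadj
    rw [r1', r2'] at hadj'
    obtain ⟨u, hu, s1, s2⟩ := hX.exists_edge hM hu1 hu2 hadj
    obtain ⟨u', hu', s1', s2'⟩ := hX.exists_edge hM hu1' hu2' hadj'
    exact ⟨u, hu, u', hu', r1.trans s1, r2.trans s2, r1'.trans s1', r2'.trans s2'⟩
  obtain ⟨a, ha, a', ha', a1, a2, a3, a4⟩ := edge p0 (by rw [hd.symm]; omega) b0 (by omega)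
    (by omega)
  obtain ⟨b, hb, b', hb', b1, b2', b3, b4⟩ := edge p2 h2 b2 (by omega) (by omega)
  have hne : p0 ≠ p2 := by
    rintro rfl
    omega
  have hx : a⁻¹ * b ∈ X true := by
    refine hX.mem_of_mem hM (mul_mem (inv_mem ha) hb) ?_
    rw [a1, vtx_eq] at b1
    exact b1.2
  have hx' : a'⁻¹ * b' ∈ X true := by
    refine hX.mem_of_mem hM (mul_mem (inv_mem ha') hb') ?_
    rw [a3, vtx_eq] at b3
    exact b3.2
  have hz : ∀ i, a'⁻¹ * h * a ∈ M i := by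
    have h1 : a'⁻¹ * h * a ∈ M true := by
      rw [a1, smul_vtx, eq_comm, vtx_eq] at a3
      simpa [mul_assoc] using a3.2
    have h2 : a'⁻¹ * h * a ∈ M false := by
      rw [a2, smul_vtx, eq_comm, vtx_eq] at a4
      simpa [mul_assoc] using a4.2
    rintro (_ | _)
    exacts [h2, h1]
  have hz' : b'⁻¹ * h * b ∈ M false := by
    rw [b2', smul_vtx, eq_comm, vtx_eq] at b4
    simpa [mul_assoc] using b4.2
  have hx1 : a⁻¹ * b ≠ 1 := by
    intro h
    rw [inv_mul_eq_one] at h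
    exact hne (by rw [a2, b2', h])
  have := hZ _ hx hx1 _ hx' _ (hz true) (hz false) (by
    have e : (a'⁻¹ * b')⁻¹ * (a'⁻¹ * h * a) * (a⁻¹ * b) = b'⁻¹ * h * b := by group
    rw [e]
    exact hz')
  have e : h = a' * (a'⁻¹ * h * a) * a⁻¹ := by group
  rw [e, this, mul_one]
  exact mul_mem ha' (inv_mem ha)

end Transverse

end IsAmalgam

theorem IsAmalgam.Transverse.lift_injective {G : Type*} [Group G] {M : Bool → Subgroup G}
    {g : Bool → G} (hM : IsAmalgam M) (hX : Transverse M fun i => Subgroup.zpowers (g i))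
    (hg : ∀ i (k : ℤ), g i ^ k = 1 → k = 0) : Function.Injective (FreeGroup.lift g) := by
  rw [injective_iff_map_eq_one]
  intro u hu
  have hmem : u ∈ Subgroup.zpowers (FreeGroup.of true) ⊔ Subgroup.zpowers (FreeGroup.of false) := by
    have : u ∈ Subgroup.closure (Set.range (FreeGroup.of (α := Bool))) := by
      rw [FreeGroup.closure_range_of]
      exact Subgroup.mem_top u
    refine (Subgroup.closure_le _).mpr ?_ this
    rintro _ ⟨_ | _, rfl⟩
    · exact Subgroup.mem_sup_right (Subgroup.mem_zpowers _)
    · exact Subgroup.mem_sup_left (Subgroup.mem_zpowers _)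
  rcases AltWord.of_mem_sup (X := fun i => Subgroup.zpowers (FreeGroup.of i)) hmem with h | ⟨i, j, h⟩
  · exact h
  · refine absurd hu (hM.ne_one i j _ (hX.word (h.map (FreeGroup.lift g) ?_)))
    rintro i _ ⟨⟨k, rfl⟩, hk⟩
    simp only [map_zpow, FreeGroup.lift_apply_of]
    refine ⟨Subgroup.zpow_mem_zpowers _ _, fun h => hk ?_⟩
    have := hg i k h
    simp [this]

theorem FreeGroup.range_lift_bool {G : Type*} [Group G] (g : Bool → G) :
    (FreeGroup.lift g).range = Subgroup.zpowers (g true) ⊔ Subgroup.zpowers (g false) := by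
  rw [FreeGroup.range_lift_eq_closure, Subgroup.zpowers_eq_closure, Subgroup.zpowers_eq_closure,
    ← Subgroup.closure_union]
  congr 1
  ext x
  simp

/-- Relators of the group with `q` generators `b₀, …, b_{q-1}` in which each generator conjugates
the next one to its square. -/
def chainRels (q : ℕ) : Set (FreeGroup ℕ) :=
  {r | ∃ i, i + 1 < q ∧
    r = FreeGroup.of i * FreeGroup.of (i + 1) * (FreeGroup.of i)⁻¹ * ((FreeGroup.of (i + 1))⁻¹) ^ 2} ∪
  {r | ∃ i, q ≤ i ∧ r = FreeGroup.of i}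

/-- The iterated Baumslag-Solitar group on `q` generators. -/
abbrev Chain (q : ℕ) : Type := PresentedGroup (chainRels q)

namespace Chain

open IsAmalgam

/-- The `i`-th generator, trivial for `i ≥ q`. -/
def b (q i : ℕ) : Chain q := PresentedGroup.of i

theorem b_of_le {q i : ℕ} (h : q ≤ i) : b q i = 1 :=
  PresentedGroup.one_of_mem (Or.inr ⟨i, h, rfl⟩)

theorem b_rel {q i : ℕ} (h : i + 1 < q) : b q i * b q (i + 1) * (b q i)⁻¹ = b q (i + 1) ^ 2 := by
  have h : PresentedGroup.mk (chainRels q) (FreeGroup.of i * FreeGroup.of (i + 1) *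
      (FreeGroup.of i)⁻¹ * ((FreeGroup.of (i + 1))⁻¹) ^ 2) = 1 :=
    PresentedGroup.one_of_mem (Or.inl ⟨i, h, rfl⟩)
  simp only [map_mul, map_inv, map_pow] at h
  rw [inv_pow, mul_inv_eq_one] at h
  exact h

/-- The homomorphism determined by the images of the generators. -/
def lift {L : Type*} [Group L] (q : ℕ) (f : ℕ → L)
    (h : ∀ i, i + 1 < q → f i * f (i + 1) * (f i)⁻¹ = f (i + 1) ^ 2) : Chain q →* L :=
  PresentedGroup.toGroup (f := fun i => if i < q then f i else 1) (by
    rintro _ (⟨i, hi, rfl⟩ | ⟨i, hi, rfl⟩)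
    · simp [hi, show i < q by omega, h i hi]
    · simp [Nat.not_lt.mpr hi])

theorem lift_b {L : Type*} [Group L] {q : ℕ} {f : ℕ → L}
    {h : ∀ i, i + 1 < q → f i * f (i + 1) * (f i)⁻¹ = f (i + 1) ^ 2} {i : ℕ} (hi : i < q) :
    lift q f h (b q i) = f i :=
  (PresentedGroup.toGroup.of _).trans (if_pos hi)

theorem hom_ext {L : Type*} [Group L] {q : ℕ} {f g : Chain q →* L}
    (h : ∀ i < q, f (b q i) = g (b q i)) : f = g := by
  refine PresentedGroup.ext fun i => ?_
  rcases lt_or_ge i q with hi | hi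
  · exact h i hi
  · have : b q i = 1 := b_of_le hi
    change f (b q i) = g (b q i)
    rw [this, map_one, map_one]

theorem eq_top {q : ℕ} (K : Subgroup (Chain q)) (h : ∀ i < q, b q i ∈ K) : K = ⊤ := by
  rw [eq_top_iff, ← PresentedGroup.closure_range_of, Subgroup.closure_le]
  rintro _ ⟨i, rfl⟩
  rcases lt_or_ge i q with hi | hi
  · exact h i hi
  · have : b q i = 1 := b_of_le hi
    change b q i ∈ K
    rw [this]
    exact one_mem K

/-- The exponent sum of the first generator. -/
def expo (q : ℕ) : Chain q →* Multiplicative ℤ :=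
  lift q (fun i => if i = 0 then Multiplicative.ofAdd 1 else 1) (by simp)

theorem expo_zero {q : ℕ} (h : 0 < q) (k : ℤ) : expo q (b q 0 ^ k) = Multiplicative.ofAdd k := by
  rw [map_zpow, expo, lift_b h, if_pos rfl, ← ofAdd_zsmul]
  simp

theorem expo_ne {q i : ℕ} (h : i ≠ 0) (k : ℤ) : expo q (b q i ^ k) = 1 := by
  rcases lt_or_ge i q with hi | hi
  · rw [map_zpow, expo, lift_b hi, if_neg h, one_zpow]
  · rw [b_of_le hi, one_zpow, map_one]

theorem b_zero_zpow {q : ℕ} (h : 0 < q) {k : ℤ} (hk : b q 0 ^ k = 1) : k = 0 := by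
  have := expo_zero h k
  rw [hk, map_one] at this
  exact this.symm

/-- The inclusion of a chain into the chain with one more generator. -/
def incl (q : ℕ) : Chain q →* Chain (q + 1) :=
  lift q (b (q + 1)) fun _ hi => b_rel (by omega)

theorem incl_b {q i : ℕ} (h : i < q) : incl q (b q i) = b (q + 1) i := lift_b h

/-- The Baumslag-Solitar group generated by the last two generators. -/
def last (m : ℕ) : BS12 →* Chain (m + 2) :=
  BS12.lift (b (m + 2) m) (b (m + 2) (m + 1)) (b_rel (by omega))

theorem last_s (m : ℕ) : last m BS12.s = b (m + 2) m := BS12.lift_s _ _ _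

theorem last_t (m : ℕ) : last m BS12.t = b (m + 2) (m + 1) := BS12.lift_t _ _ _

/-- The vertex groups of the splitting obtained by adding a generator. -/
def parts (m : ℕ) (i : Bool) : Subgroup (Chain (m + 2)) :=
  bif i then (incl (m + 1)).range else (last m).range

theorem sup_parts (m : ℕ) : (incl (m + 1)).range ⊔ (last m).range = ⊤ := by
  refine eq_top _ fun i hi => ?_
  rcases Nat.lt_succ_iff_lt_or_eq.mp hi with h | rfl
  · exact Subgroup.mem_sup_left ⟨b (m + 1) i, incl_b h⟩
  · exact Subgroup.mem_sup_right ⟨BS12.t, last_t m⟩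

theorem exists_lift (m : ℕ) (L : Type) [Group L] (φ : Chain (m + 1) →* L) (ψ : BS12 →* L)
    (h : φ (b (m + 1) m) = ψ BS12.s) :
    ∃ θ : Chain (m + 2) →* L, (∀ x, θ (incl (m + 1) x) = φ x) ∧ ∀ y, θ (last m y) = ψ y := by
  let f : ℕ → L := fun i => if i = m + 1 then ψ BS12.t else φ (b (m + 1) i)
  have f1 : f (m + 1) = ψ BS12.t := if_pos rfl
  have f2 : ∀ i < m + 1, f i = φ (b (m + 1) i) := fun i hi => if_neg (by omega)
  let θ := lift (m + 2) f (by
    intro i hi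
    rcases Nat.lt_succ_iff_lt_or_eq.mp hi with h' | h'
    · rw [f2 i (by omega), f2 (i + 1) h', ← map_inv, ← map_mul, ← map_mul, b_rel h', map_pow]
    · obtain rfl : i = m := by omega
      rw [f1, f2 i (by omega), h, ← map_inv, ← map_mul, ← map_mul, BS12.s_mul_t, map_pow])
  refine ⟨θ, fun x => ?_, fun y => ?_⟩
  · have : θ.comp (incl (m + 1)) = φ := by
      refine hom_ext fun i hi => ?_
      rw [MonoidHom.comp_apply, incl_b hi, lift_b (by omega), f2 i hi]
    exact DFunLike.congr_fun this x
  · have : θ.comp (last m) = ψ := by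
      refine MonoidHom.eq_of_eqOn_dense BS12.closure_eq_top ?_
      rintro x (rfl | rfl)
      · rw [MonoidHom.comp_apply, last_s, lift_b (by omega), f2 m (by omega), h]
      · rw [MonoidHom.comp_apply, last_t, lift_b (by omega), f1]
    exact DFunLike.congr_fun this y

theorem splitting (m : ℕ) : (∀ k : ℤ, b (m + 1) m ^ k = 1 → k = 0) ∧ IsAmalgam (parts m) ∧
    Function.Injective (incl (m + 1)) ∧ Function.Injective (last m) ∧
      (incl (m + 1)).range ⊓ (last m).range = Subgroup.zpowers (b (m + 2) m) := by
  have step : ∀ m, (∀ k : ℤ, b (m + 1) m ^ k = 1 → k = 0) → IsAmalgam (parts m) ∧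
    Function.Injective (incl (m + 1)) ∧ Function.Injective (last m) ∧
      (incl (m + 1)).range ⊓ (last m).range = Subgroup.zpowers (b (m + 2) m) := by
    intro m hm
    have hinj : ∀ {L : Type} [Group L] (x : L), (∀ k : ℤ, x ^ k = 1 → k = 0) →
        Function.Injective (zpowersHom L x) := by
      intro L _ x hx
      rw [injective_iff_map_eq_one]
      intro k hk
      exact hx _ hk
    obtain ⟨h1, h2, h3, h4⟩ := of_pushout (p := incl (m + 1)) (q := last m)
      (hinj (b (m + 1) m) hm) (hinj BS12.s fun k hk => BS12.s_zpow_eq_one hk)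
      (by
        intro k
        rw [zpowersHom_apply, zpowersHom_apply, map_zpow, map_zpow, last_s, incl_b (by omega)])
      (sup_parts m) (fun L _ φ ψ h => exists_lift m L φ ψ (by
        simpa using h (Multiplicative.ofAdd 1)))
    refine ⟨h1, h2, h3, h4.trans ?_⟩
    ext x
    simp only [MonoidHom.mem_range, MonoidHom.comp_apply, zpowersHom_apply, map_zpow,
      incl_b (Nat.lt_succ_self m), Subgroup.mem_zpowers_iff]
    exact Iff.rfl
  have hb : ∀ k : ℤ, b (m + 1) m ^ k = 1 → k = 0 := by
    induction m with
    | zero => exact fun k hk => b_zero_zpow (by omega) hk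
    | succ m ih =>
      intro k hk
      obtain ⟨-, -, h, -⟩ := step m ih
      rw [← last_t, ← map_zpow, ← map_one (last m)] at hk
      exact BS12.t_zpow_eq_one (h hk)
  exact ⟨hb, step m hb⟩

theorem last_zpow {m : ℕ} {k : ℤ} : b (m + 1) m ^ k = 1 → k = 0 := (splitting m).1 k

theorem isAmalgam (m : ℕ) : IsAmalgam (parts m) := (splitting m).2.1

theorem incl_injective (m : ℕ) : Function.Injective (incl (m + 1)) := (splitting m).2.2.1

theorem last_injective (m : ℕ) : Function.Injective (last m) := (splitting m).2.2.2.1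

theorem inter_parts (m : ℕ) :
    (incl (m + 1)).range ⊓ (last m).range = Subgroup.zpowers (b (m + 2) m) :=
  (splitting m).2.2.2.2

theorem mem_zpowers_of_mem {m : ℕ} {x : Chain (m + 2)} (h1 : x ∈ parts m true)
    (h2 : x ∈ parts m false) : x ∈ Subgroup.zpowers (b (m + 2) m) :=
  inter_parts m ▸ ⟨h1, h2⟩

theorem strongTits (m : ℕ) : StrongTits (Chain (m + 1)) := by
  induction m with
  | zero =>
    refine BS12.strongTits.of_injective (lift 1 (fun _ => BS12.s) (by omega)) ?_
    have : (zpowersHom (Chain 1) (b 1 0)).comp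
        (BS12.expo.comp (lift 1 (fun _ => BS12.s) (by omega))) = MonoidHom.id _ := by
      refine hom_ext fun i hi => ?_
      obtain rfl : i = 0 := by omega
      have h := BS12.expo_s_zpow 1
      rw [zpow_one] at h
      rw [MonoidHom.comp_apply, MonoidHom.comp_apply, lift_b hi, h]
      simp
    intro x y hxy
    have hx := DFunLike.congr_fun this x
    have hy := DFunLike.congr_fun this y
    simp only [MonoidHom.comp_apply, MonoidHom.id_apply] at hx hy
    rw [← hx, ← hy, hxy]
  | succ m ih =>
    refine StrongTits.of_isAmalgam (isAmalgam m) ?_ ?_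
    · intro f hf1 hf2 _ _ _ g hg hg' _ hgf
      by_contra hf
      obtain ⟨k, rfl⟩ := mem_zpowers_of_mem hf1 hf2
      obtain ⟨g, rfl⟩ := hg
      have h1 : (last m g)⁻¹ * b (m + 2) m ^ k * last m g ∈ parts m false :=
        mul_mem (mul_mem (inv_mem ⟨g, rfl⟩) hf2) ⟨g, rfl⟩
      obtain ⟨l, hl⟩ := mem_zpowers_of_mem hgf h1
      have hk : k ≠ 0 := by
        rintro rfl
        exact hf (zpow_zero _)
      simp only [← last_s, ← map_zpow, ← map_inv, ← map_mul] at hl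
      have := last_injective m hl
      obtain ⟨j, hj⟩ := BS12.mem_zpowers_s (g := g⁻¹) hk (by rw [inv_inv]; exact this.symm)
      have h2 : g = BS12.s ^ (-j) := by
        rw [zpow_neg]
        exact (inv_eq_iff_eq_inv.mpr hj).symm
      apply hg'
      rw [h2, map_zpow, last_s]
      have h3 : b (m + 2) m ∈ parts m true := ⟨b (m + 1) m, incl_b (by omega)⟩
      exact zpow_mem h3 _
    · rintro (_ | _)
      · refine BS12.strongTits.of_injective
          (MonoidHom.ofInjective (last_injective m)).symm.toMonoidHom ?_
        exact (MonoidHom.ofInjective (last_injective m)).symm.injective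
      · refine ih.of_injective
          (MonoidHom.ofInjective (incl_injective m)).symm.toMonoidHom ?_
        exact (MonoidHom.ofInjective (incl_injective m)).symm.injective

/-- The first and the last generator. -/
def ends (m : ℕ) (i : Bool) : Chain (m + 3) := bif i then b (m + 3) 0 else b (m + 3) (m + 2)

theorem ends_zpow (m : ℕ) (i : Bool) (k : ℤ) (h : ends m i ^ k = 1) : k = 0 := by
  cases i
  · exact last_zpow h
  · exact b_zero_zpow (by omega) h

theorem transverse (m : ℕ) :
    Transverse (parts (m + 1)) (fun i => Subgroup.zpowers (ends m i)) where
  le := by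
    rintro (_ | _)
    · rw [Subgroup.zpowers_le]
      exact ⟨BS12.t, last_t (m + 1)⟩
    · rw [Subgroup.zpowers_le]
      exact ⟨b (m + 2) 0, incl_b (by omega)⟩
  eq_one := by
    rintro (_ | _) _ ⟨k, rfl⟩ hx
    · have h2 : (b (m + 3) (m + 2)) ^ k = last (m + 1) (BS12.t ^ k) := by
        rw [map_zpow, last_t]
      have h1 : (b (m + 3) (m + 2)) ^ k ∈ parts (m + 1) false := ⟨_, h2.symm⟩
      obtain ⟨l, hl⟩ := mem_zpowers_of_mem (m := m + 1) hx h1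
      change _ ^ l = (b (m + 3) (m + 2)) ^ k at hl
      change (b (m + 3) (m + 2)) ^ k = 1
      rw [h2, ← last_s, ← map_zpow] at hl
      rw [h2, BS12.t_zpow_eq_s_zpow (last_injective _ hl).symm, map_one]
    · have h1 : b (m + 3) 0 ^ k ∈ parts (m + 1) true :=
        ⟨b (m + 2) 0 ^ k, by rw [map_zpow, incl_b (by omega)]⟩
      obtain ⟨l, hl⟩ := mem_zpowers_of_mem (m := m + 1) h1 hx
      change _ ^ l = b (m + 3) 0 ^ k at hl
      change b (m + 3) 0 ^ k = 1
      have h2 := congrArg (expo (m + 3)) hl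
      rw [expo_ne (by omega), expo_zero (by omega)] at h2
      rw [show k = 0 from h2.symm, zpow_zero]

/-- The free subgroup generated by the first and the last generator. -/
def free (m : ℕ) : Subgroup (Chain (m + 3)) :=
  Subgroup.zpowers (ends m true) ⊔ Subgroup.zpowers (ends m false)

theorem commute_zpow (m : ℕ) {k : ℤ} (hk : k ≠ 0) {h : Chain (m + 1)}
    (hh : h * b (m + 1) 0 ^ k * h⁻¹ = b (m + 1) 0 ^ k) : h ∈ Subgroup.zpowers (b (m + 1) 0) := by
  induction m with
  | zero =>
    have : Subgroup.zpowers (b 1 0) = ⊤ := by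
      refine eq_top _ fun i hi => ?_
      obtain rfl : i = 0 := by omega
      exact Subgroup.mem_zpowers _
    rw [this]
    exact Subgroup.mem_top h
  | succ m ih =>
    rcases Nat.eq_zero_or_pos m with rfl | hm
    · have htop : (last 0).range = ⊤ := by
        refine eq_top _ fun i hi => ?_
        obtain rfl | rfl : i = 0 ∨ i = 1 := by omega
        · exact ⟨_, last_s 0⟩
        · exact ⟨_, last_t 0⟩
      obtain ⟨g, rfl⟩ : h ∈ (last 0).range := htop ▸ Subgroup.mem_top h
      change last 0 g * b 2 0 ^ k * _ = b 2 0 ^ k at hh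
      change _ ∈ Subgroup.zpowers (b 2 0)
      simp only [← last_s, ← map_zpow, ← map_inv, ← map_mul] at hh ⊢
      obtain ⟨l, rfl⟩ := BS12.mem_zpowers_s hk (last_injective 0 hh)
      exact ⟨l, (map_zpow _ _ _).symm⟩
    · have hx : b (m + 2) 0 ^ k ∈ parts m true :=
        ⟨b (m + 1) 0 ^ k, by rw [map_zpow, incl_b (by omega)]⟩
      have hfix := (isAmalgam m).eq_of_fixed (i := true) hx (fun p hp hp' => by
        obtain ⟨l, hl⟩ := mem_zpowers_of_mem (mul_mem (mul_mem (inv_mem hp) hx) hp) hp'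
        have h2 := congrArg (expo (m + 2)) hl
        simp only [map_mul, map_inv] at h2
        rw [expo_ne (by omega), expo_zero (by omega), mul_comm, mul_inv_cancel_left] at h2
        exact hk h2.symm) (v := vtx _ true h) (by
          rw [smul_vtx_eq]
          have : h⁻¹ * b (m + 2) 0 ^ k * h = b (m + 2) 0 ^ k := by
            conv_lhs => rw [← hh]
            group
          rw [this]
          exact hx)
      rw [vtx_eq] at hfix
      obtain ⟨g, rfl⟩ : h ∈ parts m true := by simpa using hfix.2
      have e := incl_b (q := m + 1) (i := 0) (by omega)
      simp only [← e, ← map_zpow, ← map_inv, ← map_mul] at hh ⊢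
      obtain ⟨l, rfl⟩ := ih (incl_injective m hh)
      exact ⟨l, (map_zpow _ _ _).symm⟩

/-- Conjugates of powers of the first generator lie in the free subgroup only for the obvious
reason. -/
theorem mem_free_of_conj (m : ℕ) {k : ℤ} (hk : k ≠ 0) {h : Chain (m + 3)}
    (hh : h * b (m + 3) 0 ^ k * h⁻¹ ∈ free m) : h ∈ free m := by
  set f := h * b (m + 3) 0 ^ k * h⁻¹ with hf
  have hM := isAmalgam (m + 1)
  have hd := hM.isTree.isTreeMetric
  set o := vtx (parts (m + 1)) true 1 with ho
  have hfix : ∀ j : ℤ, f ^ j • h • o = h • o := by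
    intro j
    rw [ho, smul_vtx, smul_vtx_eq, hf, conj_zpow, ← zpow_mul]
    have hb : b (m + 3) 0 ∈ parts (m + 1) true := ⟨b (m + 2) 0, incl_b (by omega)⟩
    have := zpow_mem hb (k * j)
    simpa [mul_assoc] using this
  obtain ⟨u, hu, i, hi⟩ := (transverse m).exists_conj_mem hM hh
    (N := 2 * (tree (parts (m + 1))).dist o (h • o)) (fun j => by
      change (tree (parts (m + 1))).dist o (f ^ j • o) ≤ _
      have h1 := hd.triangle o (h • o) (f ^ j • o)
      have h2 := hM.dist_smul (f ^ j) (h • o) o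
      rw [hfix, hd.symm (h • o) o] at h2
      omega)
  have he : expo (m + 3) (u⁻¹ * f * u) = Multiplicative.ofAdd k := by
    rw [hf]
    simp only [map_mul, map_inv]
    rw [expo_zero (by omega), mul_inv_cancel_comm, mul_comm, mul_inv_cancel_left]
  obtain ⟨l, hl⟩ := hi
  change ends m i ^ l = _ at hl
  rw [← hl] at he
  cases i
  · change expo (m + 3) (b (m + 3) (m + 2) ^ l) = _ at he
    rw [expo_ne (by omega)] at he
    exact absurd he.symm hk
  · change expo (m + 3) (b (m + 3) 0 ^ l) = _ at he
    rw [expo_zero (by omega)] at he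
    obtain rfl : l = k := he
    change b (m + 3) 0 ^ l = _ at hl
    have h1 : u⁻¹ * h * b (m + 3) 0 ^ l * (u⁻¹ * h)⁻¹ = b (m + 3) 0 ^ l := by
      conv_rhs => rw [hl, hf]
      group
    have h2 : u⁻¹ * h ∈ free m := Subgroup.mem_sup_left (commute_zpow (m + 2) hk h1)
    exact (Subgroup.mul_mem_cancel_left _ (inv_mem hu)).mp h2

/-- An element of the free subgroup conjugated into the free subgroup by an outside element is
conjugate to a power of the last generator. -/
theorem exists_conj_mem_zpowers (m : ℕ) {f h : Chain (m + 4)} (hf : f ∈ free (m + 1)) (hf1 : f ≠ 1)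
    (hh : h ∉ free (m + 1)) (hfh : h * f * h⁻¹ ∈ free (m + 1)) :
    ∃ u ∈ free (m + 1), u⁻¹ * f * u ∈ Subgroup.zpowers (b (m + 4) (m + 3)) := by
  have hM := isAmalgam (m + 2)
  by_cases hb : ∃ N : ℕ, ∀ k : ℤ, (tree (parts (m + 2))).dist (vtx _ true 1)
      (f ^ k • vtx _ true 1) ≤ N
  · obtain ⟨N, hN⟩ := hb
    obtain ⟨u, hu, i, hi⟩ := (transverse (m + 1)).exists_conj_mem hM hf hN
    cases i
    · exact ⟨u, hu, hi⟩
    · obtain ⟨k, hk⟩ := hi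
      change b (m + 4) 0 ^ k = _ at hk
      have hk0 : k ≠ 0 := by
        rintro rfl
        rw [zpow_zero, eq_comm, mul_assoc, inv_mul_eq_one] at hk
        exact hf1 (by simpa using hk)
      have h1 : h * u ∈ free (m + 1) := mem_free_of_conj (m + 1) hk0 (by
        change (h * u) * b (m + 4) 0 ^ k * (h * u)⁻¹ ∈ _
        rw [hk]
        have e : h * u * (u⁻¹ * f * u) * (h * u)⁻¹ = h * f * h⁻¹ := by group
        rw [e]
        exact hfh)
      exact absurd ((Subgroup.mul_mem_cancel_right _ hu).mp h1) hh
  · push Not at hb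
    refine absurd ((transverse (m + 1)).mem_of_conj_mem hM ?_ hf hfh hb) hh
    rintro _ ⟨k, rfl⟩ hx _ ⟨k', rfl⟩ z hz1 hz2 hz3
    change b (m + 4) 0 ^ k ≠ 1 at hx
    change (b (m + 4) 0 ^ k')⁻¹ * z * b (m + 4) 0 ^ k ∈ _ at hz3
    have hb0 : b (m + 4) 0 ∈ parts (m + 2) true := ⟨b (m + 3) 0, incl_b (by omega)⟩
    obtain ⟨j, hj⟩ := mem_zpowers_of_mem hz1 hz2
    obtain ⟨j', hj'⟩ := mem_zpowers_of_mem
      (mul_mem (mul_mem (inv_mem (zpow_mem hb0 k')) hz1) (zpow_mem hb0 k)) hz3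
    change b (m + 4) (m + 2) ^ j = z at hj
    change b (m + 4) (m + 2) ^ j' = _ at hj'
    rw [← hj] at hj' ⊢
    have he := congrArg (expo (m + 4)) hj'
    rw [map_mul, map_mul, map_inv, expo_zero (by omega) k', expo_zero (by omega) k,
      expo_ne (i := m + 2) (by omega) j, expo_ne (i := m + 2) (by omega) j', mul_one,
      eq_inv_mul_iff_mul_eq, mul_one] at he
    obtain rfl : k' = k := he
    by_contra hne
    have e0 : incl (m + 3) (b (m + 3) 0) = b (m + 4) 0 := incl_b (by omega)
    have e1 : incl (m + 3) (b (m + 3) (m + 2)) = b (m + 4) (m + 2) := incl_b (by omega)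
    rw [← e0, ← e1] at hj'
    rw [← e0] at hx
    rw [← e1] at hne
    simp only [← map_zpow, ← map_inv, ← map_mul] at hj' hx hne
    have hj'' := incl_injective _ hj'
    have hx' : b (m + 3) 0 ^ k' ≠ 1 := fun h => hx (by rw [h, map_one])
    have hne' : b (m + 3) (m + 2) ^ j ≠ 1 := fun h => hne (by rw [h, map_one])
    have hne'' : b (m + 3) (m + 2) ^ j' ≠ 1 := by
      intro h
      rw [h, eq_comm, mul_assoc, inv_mul_eq_one] at hj''
      exact hne' (by simpa using hj'')
    refine (isAmalgam (m + 1)).ne_one true false ((b (m + 3) 0 ^ k')⁻¹ *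
      (b (m + 3) (m + 2) ^ j * (b (m + 3) 0 ^ k' * (b (m + 3) (m + 2) ^ j')⁻¹)))
      ((transverse m).word (.cons ⟨?_, ?_⟩ (.cons ⟨?_, ?_⟩ (.cons ⟨?_, ?_⟩ (.single ⟨?_, ?_⟩))))) ?_
    · exact inv_mem (Subgroup.zpow_mem_zpowers _ _)
    · exact inv_ne_one.mpr hx'
    · exact Subgroup.zpow_mem_zpowers _ _
    · exact hne'
    · exact Subgroup.zpow_mem_zpowers _ _
    · exact hx'
    · exact inv_mem (Subgroup.zpow_mem_zpowers _ _)
    · exact inv_ne_one.mpr hne''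
    · rw [hj'']
      group

end Chain

namespace HigmanGroup

open IsAmalgam Chain

/-- The `i`-th generator. -/
def a (n : ℕ) (i : ZMod n) : HigmanGroup n := PresentedGroup.of i

theorem a_rel (n : ℕ) (i : ZMod n) : a n i * a n (i + 1) * (a n i)⁻¹ = a n (i + 1) ^ 2 := by
  have h : PresentedGroup.mk (higmanRels n) (FreeGroup.of i * FreeGroup.of (i + 1) *
      (FreeGroup.of i)⁻¹ * ((FreeGroup.of (i + 1))⁻¹) ^ 2) = 1 :=
    PresentedGroup.one_of_mem ⟨i, rfl⟩
  simp only [map_mul, map_inv, map_pow] at h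
  rw [inv_pow, mul_inv_eq_one] at h
  exact h

/-- The homomorphism from a chain group mapping its generators to consecutive generators, starting
with the given one. -/
def arc (n s q : ℕ) : Chain q →* HigmanGroup n :=
  Chain.lift q (fun i => a n ((s + i : ℕ) : ZMod n)) fun i _ => by
    have := a_rel n ((s + i : ℕ) : ZMod n)
    rwa [← Nat.cast_succ] at this

theorem arc_b {n s q i : ℕ} (h : i < q) : arc n s q (b q i) = a n ((s + i : ℕ) : ZMod n) :=
  lift_b h

theorem sup_range (m : ℕ) : (arc (m + 5) 0 3).range ⊔ (arc (m + 5) 2 (m + 4)).range = ⊤ := by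
  rw [eq_top_iff, ← PresentedGroup.closure_range_of, Subgroup.closure_le]
  rintro _ ⟨i, rfl⟩
  change a (m + 5) i ∈ _
  have hi := ZMod.val_lt i
  rw [← ZMod.natCast_zmod_val i]
  rcases lt_or_ge i.val 2 with h | h
  · refine Subgroup.mem_sup_left ⟨b 3 i.val, ?_⟩
    rw [arc_b (by omega), Nat.zero_add]
  · refine Subgroup.mem_sup_right ⟨b (m + 4) (i.val - 2), ?_⟩
    rw [arc_b (by omega), show 2 + (i.val - 2) = i.val by omega]

theorem exists_lift (m : ℕ) (L : Type) [Group L] (φ : Chain 3 →* L) (ψ : Chain (m + 4) →* L)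
    (h0 : φ (b 3 0) = ψ (b (m + 4) (m + 3))) (h2 : φ (b 3 2) = ψ (b (m + 4) 0)) :
    ∃ θ : HigmanGroup (m + 5) →* L, (∀ x, θ (arc (m + 5) 0 3 x) = φ x) ∧
      ∀ y, θ (arc (m + 5) 2 (m + 4) y) = ψ y := by
  let c : ℕ → L := fun i => if i < 2 then φ (b 3 i) else ψ (b (m + 4) (i - 2))
  have c1 : ∀ i < 3, c i = φ (b 3 i) := by
    intro i hi
    rcases lt_or_ge i 2 with h | h
    · exact if_pos h
    · obtain rfl : i = 2 := by omega
      exact h2.symm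
  have c2 : ∀ i, c (2 + i) = ψ (b (m + 4) i) := by
    intro i
    rw [show c (2 + i) = ψ (b (m + 4) (2 + i - 2)) from if_neg (by omega), Nat.add_sub_cancel_left]
  have crel : ∀ i < m + 5, c i * c (i + 1) * (c i)⁻¹ = c (i + 1) ^ 2 := by
    intro i hi
    rcases lt_or_ge i 2 with h | h
    · rw [c1 i (by omega), c1 (i + 1) (by omega), ← map_inv, ← map_mul, ← map_mul,
        b_rel (by omega), map_pow]
    · obtain ⟨i, rfl⟩ := Nat.exists_eq_add_of_le h
      rcases lt_or_ge (i + 1) (m + 4) with h' | h'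
      · rw [add_assoc, c2, c2, ← map_inv, ← map_mul, ← map_mul, b_rel h', map_pow]
      · omega
  have cval : ∀ k ≤ m + 5, c ((k : ℕ) : ZMod (m + 5)).val = c k := by
    intro k hk
    rw [ZMod.val_natCast]
    rcases hk.lt_or_eq with h | rfl
    · rw [Nat.mod_eq_of_lt h]
    · rw [Nat.mod_self, c1 0 (by omega), h0, show m + 5 = 2 + (m + 3) by omega, c2]
  let θ : HigmanGroup (m + 5) →* L :=
    PresentedGroup.toGroup (f := fun i : ZMod (m + 5) => c i.val) (by
      rintro _ ⟨i, rfl⟩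
      have hi := ZMod.val_lt i
      have e : c (i + 1).val = c (i.val + 1) := by
        rw [← cval (i.val + 1) hi, Nat.cast_succ, ZMod.natCast_zmod_val]
      simp only [map_mul, map_inv, map_pow, FreeGroup.lift_apply_of]
      rw [inv_pow, mul_inv_eq_one, e, crel _ hi])
  have hθ : ∀ k ≤ m + 5, θ (a (m + 5) (k : ℕ)) = c k := fun k hk =>
    (PresentedGroup.toGroup.of _).trans (cval k hk)
  refine ⟨θ, fun x => ?_, fun y => ?_⟩
  · have : θ.comp (arc (m + 5) 0 3) = φ := by
      refine hom_ext fun i hi => ?_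
      rw [MonoidHom.comp_apply, arc_b hi, hθ _ (by omega), Nat.zero_add, c1 i hi]
    exact DFunLike.congr_fun this x
  · have : θ.comp (arc (m + 5) 2 (m + 4)) = ψ := by
      refine hom_ext fun i hi => ?_
      rw [MonoidHom.comp_apply, arc_b hi, hθ _ (by omega), c2]
    exact DFunLike.congr_fun this y

theorem lift_ends_injective (m : ℕ) : Function.Injective (FreeGroup.lift (ends m)) :=
  Transverse.lift_injective (Chain.isAmalgam (m + 1)) (Chain.transverse m) (ends_zpow m)

theorem range_lift_ends (m : ℕ) : (FreeGroup.lift (ends m)).range = free m :=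
  FreeGroup.range_lift_bool _

/-- Exchange of the two generators of a free group. -/
def swap : FreeGroup Bool ≃* FreeGroup Bool := FreeGroup.freeGroupCongr Equiv.boolNot

theorem splitting (m : ℕ) :
    IsAmalgam (fun i => bif i then (arc (m + 5) 0 3).range else (arc (m + 5) 2 (m + 4)).range) ∧
    Function.Injective (arc (m + 5) 0 3) ∧ Function.Injective (arc (m + 5) 2 (m + 4)) ∧
    (arc (m + 5) 0 3).range ⊓ (arc (m + 5) 2 (m + 4)).range = (free 0).map (arc (m + 5) 0 3) ∧
    (free 0).map (arc (m + 5) 0 3) = (free (m + 1)).map (arc (m + 5) 2 (m + 4)) := by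
  have e0 : arc (m + 5) 0 3 (ends 0 true) = arc (m + 5) 2 (m + 4) (ends (m + 1) false) := by
    change arc _ _ _ (b 3 0) = arc _ _ _ (b (m + 4) (m + 3))
    rw [arc_b (by omega), arc_b (by omega), show 2 + (m + 3) = m + 5 by omega,
      ZMod.natCast_self, Nat.cast_zero]
  have e1 : arc (m + 5) 0 3 (ends 0 false) = arc (m + 5) 2 (m + 4) (ends (m + 1) true) := by
    change arc _ _ _ (b 3 2) = arc _ _ _ (b (m + 4) 0)
    rw [arc_b (by omega), arc_b (by omega)]
  have hc : (arc (m + 5) 0 3).comp (FreeGroup.lift (ends 0)) =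
      (arc (m + 5) 2 (m + 4)).comp ((FreeGroup.lift (ends (m + 1))).comp swap.toMonoidHom) := by
    ext i
    cases i
    · simpa [swap] using e1
    · simpa [swap] using e0
  have hs : swap.toMonoidHom.range = ⊤ := MonoidHom.range_eq_top.mpr swap.surjective
  obtain ⟨h1, h2, h3, h4⟩ := of_pushout (lift_ends_injective 0)
    (β := (FreeGroup.lift (ends (m + 1))).comp swap.toMonoidHom)
    ((lift_ends_injective (m + 1)).comp swap.injective) (DFunLike.congr_fun hc) (sup_range m)
    (fun L _ φ ψ h => exists_lift m L φ ψ
      (by simpa [swap, ends] using h (FreeGroup.of true))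
      (by simpa [swap, ends] using h (FreeGroup.of false)))
  refine ⟨h1, h2, h3, ?_, ?_⟩
  · rw [h4, MonoidHom.range_comp, range_lift_ends]
  · rw [← range_lift_ends, ← MonoidHom.range_comp, hc, MonoidHom.range_comp,
      MonoidHom.range_comp, hs,
      ← MonoidHom.range_eq_map, range_lift_ends]

theorem strongTits (m : ℕ) : StrongTits (HigmanGroup (m + 5)) := by
  obtain ⟨hM, hA, hB, hAB, hfree⟩ := splitting m
  refine StrongTits.of_isAmalgam hM ?_ ?_
  · intro f hf1 hf2 x hx hx' y hy hy' hxf hyf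
    by_contra hf
    have key : ∀ z, z ∈ (arc (m + 5) 0 3).range → z ∈ (arc (m + 5) 2 (m + 4)).range →
        z ∈ (free 0).map (arc (m + 5) 0 3) := fun z h h' => hAB ▸ ⟨h, h'⟩
    obtain ⟨f0, hf0, rfl⟩ := hfree ▸ key f hf1 hf2
    obtain ⟨y, rfl⟩ := hy
    obtain ⟨x, rfl⟩ := hx
    have hfr : (free (m + 1)).map (arc (m + 5) 2 (m + 4)) ≤ (arc (m + 5) 0 3).range := by
      rw [← hfree]
      exact Subgroup.map_le_range _ _
    have hy0 : y⁻¹ ∉ free (m + 1) := fun h =>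
      hy' (hfr ⟨y, by simpa using inv_mem h, rfl⟩)
    have hyf0 : y⁻¹ * f0 * y⁻¹⁻¹ ∈ free (m + 1) := by
      obtain ⟨z, hz, hz'⟩ := hfree ▸ key _ hyf ⟨y⁻¹ * f0 * y, by simp⟩
      rw [← map_inv, ← map_mul, ← map_mul] at hz'
      rw [inv_inv, ← hB hz']
      exact hz
    obtain ⟨u, hu, k, hk⟩ := exists_conj_mem_zpowers m hf0 (fun h => hf (by rw [h, map_one]))
      hy0 hyf0
    change b (m + 4) (m + 3) ^ k = _ at hk
    have hu' : arc (m + 5) 2 (m + 4) u ∈ (free 0).map (arc (m + 5) 0 3) := hfree ▸ ⟨u, hu, rfl⟩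
    obtain ⟨v, hv, hvu⟩ := hu'
    have e0 : arc (m + 5) 2 (m + 4) (b (m + 4) (m + 3)) = arc (m + 5) 0 3 (b 3 0) := by
      rw [arc_b (by omega), arc_b (by omega), show 2 + (m + 3) = m + 5 by omega,
        ZMod.natCast_self, Nat.cast_zero]
    have hfv : arc (m + 5) 2 (m + 4) f0 = arc (m + 5) 0 3 (v * b 3 0 ^ k * v⁻¹) := by
      rw [map_mul, map_mul, map_inv, map_zpow, hvu, ← e0, ← map_zpow, hk, ← map_inv, ← map_mul,
        ← map_mul]
      congr 1
      group
    have hk0 : k ≠ 0 := by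
      rintro rfl
      rw [hfv] at hf
      exact hf (by simp)
    have hconj : x⁻¹ * v * b 3 0 ^ k * (x⁻¹ * v)⁻¹ ∈ free 0 := by
      rw [hfv] at hxf
      obtain ⟨z, hz, hz'⟩ := key _ ⟨x⁻¹ * (v * b 3 0 ^ k * v⁻¹) * x, by simp⟩ hxf
      rw [← map_inv, ← map_mul, ← map_mul] at hz'
      have := hA hz'
      rw [show x⁻¹ * v * b 3 0 ^ k * (x⁻¹ * v)⁻¹ = x⁻¹ * (v * b 3 0 ^ k * v⁻¹) * x by group,
        ← this]
      exact hz
    have hxv := mem_free_of_conj 0 hk0 hconj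
    have hx0 : x ∈ free 0 := by
      have := (Subgroup.mul_mem_cancel_right _ hv).mp hxv
      simpa using this
    exact hx' ((hAB ▸ ⟨x, hx0, rfl⟩ : _ ∈ (arc (m + 5) 0 3).range ⊓ _).2)
  · rintro (_ | _)
    · refine (Chain.strongTits (m + 3)).of_injective
        (MonoidHom.ofInjective hB).symm.toMonoidHom ?_
      exact (MonoidHom.ofInjective hB).symm.injective
    · refine (Chain.strongTits 2).of_injective (MonoidHom.ofInjective hA).symm.toMonoidHom ?_
      exact (MonoidHom.ofInjective hA).symm.injective

end HigmanGroup

theorem higman_strong_tits_alternative (n : ℕ) (hn : 5 ≤ n)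
    (H : Subgroup (HigmanGroup n)) (hH : ¬ IsCyclic H) :
    (∃ f : H →* BS12, Function.Injective f) ∨ IsAcylindricallyHyperbolic H := by
  obtain ⟨m, rfl⟩ := Nat.exists_eq_add_of_le' hn
  exact ((HigmanGroup.strongTits m H H.subtype H.subtype_injective).2).resolve_left hH
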